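/- Let u be an admissible solution of the vorticity equation on [0,T) with viscosity ν > 0, with enstrophy E(t) = (1/2)‖ω(t,·)‖²_{L²(ℝ³)}, and suppose E(0) > 0. Then for all t ∈ [0,T) with t < 1728 π⁴ ν³ / E(0)², one has E(t) ≤ E(0) / √(1 − E(0)² t / (1728 π⁴ ν³)). -/

import Mathlib

open MeasureTheory Real SchwartzMap
open scoped FourierTransform ENNReal

noncomputable section

/-- Euclidean three-space. -/
abbrev E3 : Type := EuclideanSpace ℝ (Fin 3)

/-- The `i`-th standard basis vector. -/
def ee (i : Fin 3) : E3 := EuclideanSpace.single i 1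

/-- The partial derivative `∂ᵢ f`. -/
def pd (i : Fin 3) (f : E3 → ℝ) : E3 → ℝ := fun x => fderiv ℝ f x (ee i)

/-- The Fourier transform (kernel `e^{-2πi x·ξ}`) of a real-valued function. -/
def ft (f : E3 → ℝ) : E3 → ℂ := 𝓕 (fun x => (f x : ℂ))

/-- The squared homogeneous Sobolev norm `‖v‖²_{Ḣ^s}` of a vector field. -/
def hsV (s : ℝ) (v : Fin 3 → E3 → ℝ) : ℝ :=
  ∫ ξ : E3, (2 * π * ‖ξ‖) ^ (2 * s) * ∑ i, ‖ft (v i) ξ‖ ^ 2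

/-- The curl `ω = ∇ × u` of a vector field. -/
def curl (u : Fin 3 → E3 → ℝ) : Fin 3 → E3 → ℝ :=
  ![fun x => pd 1 (u 2) x - pd 2 (u 1) x,
    fun x => pd 2 (u 0) x - pd 0 (u 2) x,
    fun x => pd 0 (u 1) x - pd 1 (u 0) x]

/-- The strain tensor `S = (∇u + (∇u)ᵀ)/2`. -/
def strain (u : Fin 3 → E3 → ℝ) : Fin 3 → Fin 3 → E3 → ℝ :=
  fun i j x => (pd i (u j) x + pd j (u i) x) / 2

/-- The time interval `[0,T)` for `T ∈ (0,∞]`. -/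
def timeSet (T : ℝ≥0∞) : Set ℝ := {t : ℝ | 0 ≤ t ∧ ENNReal.ofReal t < T}

/-- An admissible solution of the vorticity equation on `[0,T)` with viscosity `ν`:
`u` is jointly smooth, Schwartz in space at each time with time-locally uniform
Schwartz seminorm bounds (also for `∂ₜu`), divergence free, and its vorticity
`ω = ∇×u` satisfies `∂ₜω − νΔω + (u·∇)ω − Sω = 0` on `[0,T) × ℝ³`. -/
structure AdmissibleSolution (ν : ℝ) (T : ℝ≥0∞) where
  u : ℝ → Fin 3 → 𝓢(E3, ℝ)
  u' : ℝ → Fin 3 → 𝓢(E3, ℝ)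
  smooth : ∀ i : Fin 3,
    ContDiffOn ℝ (⊤ : ℕ∞) (fun p : ℝ × E3 => u p.1 i p.2) (timeSet T ×ˢ Set.univ)
  tderiv : ∀ t ∈ timeSet T, ∀ i : Fin 3, ∀ x : E3,
    HasDerivWithinAt (fun s => u s i x) (u' t i x) (timeSet T) t
  seminorm_bdd : ∀ K : Set ℝ, IsCompact K → K ⊆ timeSet T → ∀ k n : ℕ, ∀ i : Fin 3,
    ∃ C : ℝ, ∀ t ∈ K, SchwartzMap.seminorm ℝ k n (u t i) ≤ C ∧
      SchwartzMap.seminorm ℝ k n (u' t i) ≤ C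
  divfree : ∀ t ∈ timeSet T, ∀ x : E3, ∑ i, pd i (⇑(u t i)) x = 0
  vort_eq : ∀ t ∈ timeSet T, ∀ x : E3, ∀ k : Fin 3,
    derivWithin (fun s => curl (fun i => ⇑(u s i)) k x) (timeSet T) t
      - ν * (∑ i, pd i (pd i (curl (fun i => ⇑(u t i)) k)) x)
      + (∑ i, u t i x * pd i (curl (fun i => ⇑(u t i)) k) x)
      - (∑ j, strain (fun i => ⇑(u t i)) k j x * curl (fun i => ⇑(u t i)) j x) = 0

/-- The vorticity of an admissible solution at time `t`. -/
def AdmissibleSolution.vort {ν : ℝ} {T : ℝ≥0∞} (sol : AdmissibleSolution ν T)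
    (t : ℝ) : Fin 3 → E3 → ℝ :=
  curl (fun i => ⇑(sol.u t i))

/-- The horizontal part `ω_h = (ω₁, ω₂, 0)` of the vorticity. -/
def AdmissibleSolution.vorth {ν : ℝ} {T : ℝ≥0∞} (sol : AdmissibleSolution ν T)
    (t : ℝ) : Fin 3 → E3 → ℝ :=
  ![sol.vort t 0, sol.vort t 1, fun _ => 0]

/-- The enstrophy `E(t) = (1/2)‖ω(t,·)‖²_{L²}`. -/
def AdmissibleSolution.enstrophy {ν : ℝ} {T : ℝ≥0∞} (sol : AdmissibleSolution ν T)
    (t : ℝ) : ℝ :=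
  (1 / 2) * ∫ x : E3, ∑ k, (sol.vort t k x) ^ 2

namespace NS

/-- The partial derivative on Schwartz functions. -/
def dd (i : Fin 3) (f : 𝓢(E3, ℝ)) : 𝓢(E3, ℝ) := LineDeriv.lineDerivOp (ee i) f

/-- Product of Schwartz functions. -/
def sm (f g : 𝓢(E3, ℝ)) : 𝓢(E3, ℝ) := SchwartzMap.pairing (ContinuousLinearMap.mul ℝ ℝ) f g

lemma sm_apply (f g : 𝓢(E3, ℝ)) (x : E3) : sm f g x = f x * g x := rfl

lemma dd_apply (i : Fin 3) (f : 𝓢(E3, ℝ)) (x : E3) : dd i f x = fderiv ℝ f x (ee i) := rfl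

lemma dd_pd (i : Fin 3) (f : 𝓢(E3, ℝ)) : ⇑(dd i f) = pd i ⇑f := rfl

lemma dd_line (i : Fin 3) (f : 𝓢(E3, ℝ)) (x : E3) :
    HasLineDerivAt ℝ f (dd i f x) x (ee i) :=
  (f.hasFDerivAt x).hasLineDerivAt (ee i)

lemma dd_add (i : Fin 3) (f g : 𝓢(E3, ℝ)) : dd i (f + g) = dd i f + dd i g :=
  LineDeriv.lineDerivOp_add _ _ _

lemma dd_sub (i : Fin 3) (f g : 𝓢(E3, ℝ)) : dd i (f - g) = dd i f - dd i g := by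
  rw [eq_sub_iff_add_eq, ← dd_add, sub_add_cancel]

lemma dd_smul (i : Fin 3) (c : ℝ) (f : 𝓢(E3, ℝ)) : dd i (c • f) = c • dd i f :=
  LineDeriv.lineDerivOp_smul _ _ _

lemma dd_zero (i : Fin 3) : dd i (0 : 𝓢(E3, ℝ)) = 0 := by
  have := dd_smul i 0 0
  simpa using this

lemma dd_sum {ι : Type*} (s : Finset ι) (i : Fin 3) (f : ι → 𝓢(E3, ℝ)) :
    dd i (∑ j ∈ s, f j) = ∑ j ∈ s, dd i (f j) := by
  classical
  induction s using Finset.induction_on with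
  | empty => simp [dd_zero]
  | insert a s ha ih => rw [Finset.sum_insert ha, Finset.sum_insert ha, dd_add, ih]

lemma dd_sm (i : Fin 3) (f g : 𝓢(E3, ℝ)) : dd i (sm f g) = sm (dd i f) g + sm f (dd i g) := by
  ext x
  have h : HasFDerivAt (fun y => f y * g y) (f x • fderiv ℝ g x + g x • fderiv ℝ f x) x :=
    (f.hasFDerivAt x).mul (g.hasFDerivAt x)
  have h2 : dd i (sm f g) x = fderiv ℝ (fun y => f y * g y) x (ee i) := rfl
  rw [h2, h.fderiv]
  simp [sm_apply, dd_apply]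
  ring

lemma dd_comm (i j : Fin 3) (f : 𝓢(E3, ℝ)) : dd i (dd j f) = dd j (dd i f) := by
  ext x
  have hd : DifferentiableAt ℝ (fderiv ℝ f) x :=
    ((f.smooth 2).fderiv_right (m := 1) (by norm_num)).differentiable (by norm_num) x
  have key : ∀ a b : Fin 3, dd a (dd b f) x = fderiv ℝ (fderiv ℝ f) x (ee a) (ee b) := by
    intro a b
    have h2 : dd a (dd b f) x = fderiv ℝ (fun y => fderiv ℝ f y (ee b)) x (ee a) := rfl
    rw [h2, fderiv_clm_apply hd (by fun_prop)]
    simp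
  rw [key, key]
  have hs : IsSymmSndFDerivAt ℝ f x :=
    ContDiffAt.isSymmSndFDerivAt (n := 2) (f.smooth 2).contDiffAt (by simp)
  exact hs _ _

lemma int_mul_dd (i : Fin 3) (f g : 𝓢(E3, ℝ)) :
    ∫ x, f x * dd i g x = - ∫ x, dd i f x * g x :=
  SchwartzMap.integral_mul_lineDerivOp_right_eq_neg_left f g (ee i)

lemma integrable_mul_bdd {B : E3 → ℝ} (hB : Continuous B) {C : ℝ} (hC : ∀ x, |B x| ≤ C)
    (f : 𝓢(E3, ℝ)) : Integrable (fun x => B x * f x) :=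
  f.integrable.bdd_mul (c := C) hB.aestronglyMeasurable (Filter.Eventually.of_forall hC)

lemma ibp_bdd (i : Fin 3) {B B' : E3 → ℝ} (hB : Continuous B) (hB' : Continuous B')
    {C C' : ℝ} (hC : ∀ x, |B x| ≤ C) (hC' : ∀ x, |B' x| ≤ C')
    (hd : ∀ x, HasLineDerivAt ℝ B (B' x) x (ee i)) (f : 𝓢(E3, ℝ)) :
    ∫ x, B x * dd i f x = - ∫ x, B' x * f x :=
  integral_bilinear_hasLineDerivAt_right_eq_neg_left_of_integrable
    (B := ContinuousLinearMap.mul ℝ ℝ) (v := ee i) (f := B) (f' := B') (g := f) (g' := dd i f)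
    (integrable_mul_bdd hB' hC' f) (integrable_mul_bdd hB hC _) (integrable_mul_bdd hB hC f)
    (fun x _ => hd x) (fun x _ => dd_line i f x)

lemma int_dd (i : Fin 3) (f : 𝓢(E3, ℝ)) : ∫ x, dd i f x = 0 := by
  have h := ibp_bdd i (B := fun _ => 1) (B' := fun _ => 0) (C := 1) (C' := 0) continuous_const
    continuous_const (by simp) (by simp) (fun x => by
      have := (hasFDerivAt_const (1:ℝ) x (𝕜 := ℝ)).hasLineDerivAt (ee i)
      simpa using this) f
  simpa using h

lemma sch_bdd (f : 𝓢(E3, ℝ)) : ∃ C : ℝ, 0 ≤ C ∧ ∀ x, |f x| ≤ C :=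
  ⟨SchwartzMap.seminorm ℝ 0 0 f, apply_nonneg _ _, fun x => SchwartzMap.norm_le_seminorm ℝ f x⟩

end NS


namespace NS

/-- regularised radius -/
def sr (δ : ℝ) (z : E3) : ℝ := √(‖z‖ ^ 2 + δ ^ 2)

lemma sr_pos {δ : ℝ} (hδ : 0 < δ) (z : E3) : 0 < sr δ z :=
  Real.sqrt_pos.2 (by positivity)

lemma sr_sq (δ : ℝ) (z : E3) : sr δ z ^ 2 = ‖z‖ ^ 2 + δ ^ 2 :=
  Real.sq_sqrt (by positivity)

lemma sr_ge {δ : ℝ} (_hδ : 0 < δ) (z : E3) : δ ≤ sr δ z := by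
  apply Real.le_sqrt_of_sq_le
  nlinarith [sq_nonneg ‖z‖]

lemma sr_cont (δ : ℝ) : Continuous (sr δ) := by
  unfold sr
  fun_prop

lemma sr_neg (δ : ℝ) (z : E3) : sr δ (-z) = sr δ z := by simp [sr]

lemma sum_sq_eq (z : E3) : ∑ l, z l ^ 2 = ‖z‖ ^ 2 := by
  rw [EuclideanSpace.norm_sq_eq]
  simp

lemma inner_ee (z : E3) (i : Fin 3) : inner ℝ z (ee i) = z i := by
  simp [ee, EuclideanSpace.inner_single_right]

lemma sr_fd {δ : ℝ} (hδ : 0 < δ) (z : E3) (i : Fin 3) :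
    HasLineDerivAt ℝ (sr δ) (z i / sr δ z) z (ee i) := by
  have h1 : HasFDerivAt (fun y : E3 => ‖y‖ ^ 2 + δ ^ 2) (2 • (innerSL ℝ z)) z :=
    (hasStrictFDerivAt_norm_sq z).hasFDerivAt.add_const _
  have h2 := (h1.sqrt (by positivity)).hasLineDerivAt (ee i)
  have h3 := sr_pos hδ z
  refine HasDerivAt.congr_deriv h2 ?_
  simp [inner_ee, sr]
  field_simp

lemma coord_fd (z : E3) (i : Fin 3) : HasLineDerivAt ℝ (fun y : E3 => y i) 1 z (ee i) := by
  have h := ((EuclideanSpace.proj i : E3 →L[ℝ] ℝ).hasFDerivAt (x := z)).hasLineDerivAt (ee i)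
  simpa [ee] using h

/-- inverse radius -/
def rw_ (δ : ℝ) (z : E3) : ℝ := (sr δ z)⁻¹
/-- exponential factor -/
def rx (a δ : ℝ) (z : E3) : ℝ := Real.exp (-a * sr δ z)
/-- direction cosine -/
def rc (δ : ℝ) (l : Fin 3) (z : E3) : ℝ := z l * (sr δ z)⁻¹

lemma rw_line {δ : ℝ} (hδ : 0 < δ) (z : E3) (i : Fin 3) :
    HasLineDerivAt ℝ (rw_ δ) (-(rw_ δ z) ^ 2 * rc δ i z) z (ee i) := by
  have h := sr_fd hδ z i
  unfold HasLineDerivAt at h ⊢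
  have h3 := sr_pos hδ z
  have h2 := h.inv (by simpa using h3.ne')
  refine HasDerivAt.congr_deriv h2 ?_
  simp [rw_, rc]
  field_simp

lemma rx_line {a δ : ℝ} (hδ : 0 < δ) (z : E3) (i : Fin 3) :
    HasLineDerivAt ℝ (rx a δ) (-a * rx a δ z * rc δ i z) z (ee i) := by
  have h := sr_fd hδ z i
  unfold HasLineDerivAt at h ⊢
  have h2 := (h.const_mul (-a)).exp
  refine HasDerivAt.congr_deriv h2 ?_
  simp [rx, rc]
  ring

lemma rc_line {δ : ℝ} (hδ : 0 < δ) (z : E3) (i : Fin 3) :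
    HasLineDerivAt ℝ (rc δ i) (rw_ δ z * (1 - rc δ i z ^ 2)) z (ee i) := by
  have h := rw_line hδ z i
  have h1 := coord_fd z i
  unfold HasLineDerivAt at h h1 ⊢
  have h2 := h1.mul h
  refine HasDerivAt.congr_deriv h2 ?_
  simp [rw_, rc]
  ring

lemma rc_abs {δ : ℝ} (hδ : 0 < δ) (z : E3) (l : Fin 3) : |rc δ l z| ≤ 1 := by
  have h3 := sr_pos hδ z
  unfold rc
  rw [abs_mul, abs_inv, abs_of_pos h3, ← div_eq_mul_inv, div_le_one h3]
  apply Real.le_sqrt_of_sq_le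
  rw [sq_abs, ← sum_sq_eq]
  have : z l ^ 2 ≤ ∑ l, z l ^ 2 :=
    Finset.single_le_sum (f := fun l => z l ^ 2) (fun i _ => sq_nonneg _) (Finset.mem_univ l)
  nlinarith [sq_nonneg δ]

lemma rc_sum {δ : ℝ} (hδ : 0 < δ) (z : E3) :
    ∑ l, rc δ l z ^ 2 = 1 - δ ^ 2 * rw_ δ z ^ 2 := by
  have h3 := sr_pos hδ z
  have h4 := sr_sq δ z
  simp only [rc, rw_, mul_pow, ← Finset.sum_mul, sum_sq_eq]
  field_simp
  linarith

lemma rx_cont (a δ : ℝ) : Continuous (rx a δ) := by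
  have := sr_cont δ
  unfold rx
  fun_prop

lemma rw_cont {δ : ℝ} (hδ : 0 < δ) : Continuous (rw_ δ) :=
  (sr_cont δ).inv₀ (fun z => (sr_pos hδ z).ne')

lemma rc_cont {δ : ℝ} (hδ : 0 < δ) (l : Fin 3) : Continuous (rc δ l) := by
  have := rw_cont hδ
  unfold rw_ at this
  unfold rc
  fun_prop

/-- bounded continuous -/
def BC (B : E3 → ℝ) : Prop := Continuous B ∧ ∃ C : ℝ, ∀ x, |B x| ≤ C

lemma BC.add {B C : E3 → ℝ} (hB : BC B) (hC : BC C) : BC (fun z => B z + C z) := by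
  obtain ⟨h1, c1, h2⟩ := hB
  obtain ⟨h3, c2, h4⟩ := hC
  exact ⟨h1.add h3, c1 + c2, fun x => (abs_add_le _ _).trans (add_le_add (h2 x) (h4 x))⟩

lemma BC.mul {B C : E3 → ℝ} (hB : BC B) (hC : BC C) : BC (fun z => B z * C z) := by
  obtain ⟨h1, c1, h2⟩ := hB
  obtain ⟨h3, c2, h4⟩ := hC
  refine ⟨h1.mul h3, c1 * c2, fun x => ?_⟩
  rw [abs_mul]
  exact mul_le_mul (h2 x) (h4 x) (abs_nonneg _) ((abs_nonneg _).trans (h2 x))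

lemma BC.const (c : ℝ) : BC (fun _ => c) := ⟨continuous_const, |c|, fun _ => le_rfl⟩

lemma BC.neg {B : E3 → ℝ} (hB : BC B) : BC (fun z => - B z) := by
  simpa using (BC.const (-1)).mul hB

lemma BC.sub {B C : E3 → ℝ} (hB : BC B) (hC : BC C) : BC (fun z => B z - C z) := by
  simpa [sub_eq_add_neg] using hB.add hC.neg

lemma BC.pow {B : E3 → ℝ} (hB : BC B) (n : ℕ) : BC (fun z => B z ^ n) := by
  induction n with
  | zero => simpa using BC.const 1
  | succ n ih => simpa [pow_succ] using ih.mul hB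

lemma BC.sum {ι : Type*} (s : Finset ι) {B : ι → E3 → ℝ} (hB : ∀ i, BC (B i)) :
    BC (fun z => ∑ i ∈ s, B i z) := by
  classical
  induction s using Finset.induction_on with
  | empty => simpa using BC.const 0
  | insert a s ha ih => simpa [Finset.sum_insert ha] using (hB a).add ih

lemma BC.sch (f : 𝓢(E3, ℝ)) : BC f := ⟨f.continuous, (sch_bdd f).imp fun _ h => h.2⟩

lemma BC.int {B : E3 → ℝ} (hB : BC B) (f : 𝓢(E3, ℝ)) : Integrable (fun x => B x * f x) := by
  obtain ⟨h1, c1, h2⟩ := hB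
  exact integrable_mul_bdd h1 h2 f

lemma BC.ibp (i : Fin 3) {B B' : E3 → ℝ} (hB : BC B) (hB' : BC B')
    (hd : ∀ x, HasLineDerivAt ℝ B (B' x) x (ee i)) (f : 𝓢(E3, ℝ)) :
    ∫ x, B x * dd i f x = - ∫ x, B' x * f x := by
  obtain ⟨h1, c1, h2⟩ := hB
  obtain ⟨h3, c3, h4⟩ := hB'
  exact ibp_bdd i h1 h3 h2 h4 hd f

lemma rx_BC {a δ : ℝ} (ha : 0 < a) (hδ : 0 < δ) : BC (rx a δ) := by
  refine ⟨rx_cont _ _, 1, fun z => ?_⟩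
  have := sr_pos hδ z
  rw [rx, abs_of_pos (Real.exp_pos _)]
  apply Real.exp_le_one_iff.2
  nlinarith

lemma rw_BC {δ : ℝ} (hδ : 0 < δ) : BC (rw_ δ) := by
  refine ⟨rw_cont hδ, δ⁻¹, fun z => ?_⟩
  have := sr_pos hδ z
  rw [rw_, abs_of_pos (inv_pos.2 this)]
  exact inv_anti₀ hδ (sr_ge hδ z)

lemma rc_BC {δ : ℝ} (hδ : 0 < δ) (l : Fin 3) : BC (rc δ l) :=
  ⟨rc_cont hδ l, 1, fun z => rc_abs hδ z l⟩

/-- double integrals -/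
def II (k : E3 → ℝ) (f g : 𝓢(E3, ℝ)) : ℝ := ∫ p : E3 × E3, k (p.1 - p.2) * (f p.1 * g p.2)

lemma II_int {k : E3 → ℝ} (hk : BC k) (f g : 𝓢(E3, ℝ)) :
    Integrable (fun p : E3 × E3 => k (p.1 - p.2) * (f p.1 * g p.2)) := by
  obtain ⟨h1, c, h2⟩ := hk
  refine (f.integrable.mul_prod g.integrable).bdd_mul (c := c) ?_
    (Filter.Eventually.of_forall fun p => h2 _)
  exact (h1.comp (by fun_prop)).aestronglyMeasurable

lemma II_one (f g : 𝓢(E3, ℝ)) : II (fun _ => 1) f g = (∫ x, f x) * ∫ x, g x := by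
  unfold II
  simp only [one_mul]
  exact integral_prod_mul (f : E3 → ℝ) g

lemma II_eq {k : E3 → ℝ} (hk : BC k) (f g : 𝓢(E3, ℝ)) :
    II k f g = ∫ x, f x * ∫ y, k (x - y) * g y := by
  unfold II
  rw [Measure.volume_eq_prod, integral_prod _ (II_int hk f g)]
  congr 1; ext x
  rw [← integral_const_mul]
  congr 1; ext y; ring

lemma II_eq' {k : E3 → ℝ} (hk : BC k) (f g : 𝓢(E3, ℝ)) :
    II k f g = ∫ y, g y * ∫ x, k (x - y) * f x := by
  unfold II
  rw [Measure.volume_eq_prod, integral_prod_symm _ (II_int hk f g)]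
  congr 1; ext x
  rw [← integral_const_mul]
  congr 1; ext y; ring

lemma BC.shift {k : E3 → ℝ} (hk : BC k) (y : E3) : BC (fun x => k (x - y)) := by
  obtain ⟨h1, c, h2⟩ := hk
  exact ⟨h1.comp (by fun_prop), c, fun x => h2 _⟩

lemma BC.shift' {k : E3 → ℝ} (hk : BC k) (x : E3) : BC (fun y => k (x - y)) := by
  obtain ⟨h1, c, h2⟩ := hk
  exact ⟨h1.comp (by fun_prop), c, fun x => h2 _⟩

lemma line_shift {k k' : E3 → ℝ} {i : Fin 3} (hd : ∀ x, HasLineDerivAt ℝ k (k' x) x (ee i))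
    (x y : E3) : HasLineDerivAt ℝ (fun x => k (x - y)) (k' (x - y)) x (ee i) := by
  have := hd (x - y)
  unfold HasLineDerivAt at this ⊢
  convert this using 3
  abel

lemma line_shift' {k k' : E3 → ℝ} {i : Fin 3} (hd : ∀ x, HasLineDerivAt ℝ k (k' x) x (ee i))
    (x y : E3) : HasLineDerivAt ℝ (fun y => k (x - y)) (- k' (x - y)) y (ee i) := by
  have := hd (x - y)
  unfold HasLineDerivAt at this ⊢
  have h2 : HasDerivAt (fun t : ℝ => -t) (-1) 0 := hasDerivAt_neg 0
  have h3 := HasDerivAt.scomp (h := fun t : ℝ => -t) 0 (by simpa using this) h2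
  convert h3 using 1
  · ext t
    simp only [Function.comp]
    congr 1
    rw [neg_smul]; abel
  · simp

lemma II_dd1 (i : Fin 3) {k k' : E3 → ℝ} (hk : BC k) (hk' : BC k')
    (hd : ∀ x, HasLineDerivAt ℝ k (k' x) x (ee i)) (f g : 𝓢(E3, ℝ)) :
    II k (dd i f) g = - II k' f g := by
  rw [II_eq' hk, II_eq' hk', ← integral_neg]
  congr 1; ext y
  rw [BC.ibp i (hk.shift y) (hk'.shift y) (fun x => line_shift hd x y)]
  ring

lemma conv_dd (i : Fin 3) {k k' : E3 → ℝ} (hk : BC k) (hk' : BC k')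
    (hd : ∀ x, HasLineDerivAt ℝ k (k' x) x (ee i)) (g : 𝓢(E3, ℝ)) (x : E3) :
    ∫ y, k (x - y) * dd i g y = ∫ y, k' (x - y) * g y := by
  rw [BC.ibp i (hk.shift' x) ((hk'.shift' x).neg) (fun y => line_shift' hd x y), ← integral_neg]
  simp

lemma II_dd2 (i : Fin 3) {k k' : E3 → ℝ} (hk : BC k) (hk' : BC k')
    (hd : ∀ x, HasLineDerivAt ℝ k (k' x) x (ee i)) (f g : 𝓢(E3, ℝ)) :
    II k f (dd i g) = II k' f g := by
  rw [II_eq hk, II_eq hk']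
  simp only [conv_dd i hk hk' hd]

end NS


namespace NS

lemma sch_sum_apply {ι : Type*} (s : Finset ι) (f : ι → 𝓢(E3, ℝ)) (x : E3) :
    (∑ j ∈ s, f j) x = ∑ j ∈ s, f j x := by
  classical
  induction s using Finset.induction_on with
  | empty => simp
  | insert a s ha ih => rw [Finset.sum_insert ha, Finset.sum_insert ha, add_apply, ih]

/-- density of a family -/
def rho {ι : Type*} [Fintype ι] (S : ι → 𝓢(E3, ℝ)) : 𝓢(E3, ℝ) := ∑ i, sm (S i) (S i)

/-- gradient density of a family -/
def gD {ι : Type*} [Fintype ι] (S : ι → 𝓢(E3, ℝ)) : 𝓢(E3, ℝ) :=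
  ∑ i, ∑ l, sm (dd l (S i)) (dd l (S i))

variable {ι : Type*} [Fintype ι]

lemma rho_apply (S : ι → 𝓢(E3, ℝ)) (x : E3) : rho S x = ∑ i, S i x ^ 2 := by
  simp [rho, sm_apply, sq]

lemma gD_apply (S : ι → 𝓢(E3, ℝ)) (x : E3) : gD S x = ∑ i, ∑ l, dd l (S i) x ^ 2 := by
  simp [gD, sm_apply, sq]

lemma dd_rho (S : ι → 𝓢(E3, ℝ)) (l : Fin 3) (x : E3) :
    dd l (rho S) x = 2 * ∑ i, S i x * dd l (S i) x := by
  simp only [rho, dd_sum, sch_sum_apply, dd_sm, add_apply, sm_apply, Finset.mul_sum]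
  refine Finset.sum_congr rfl fun i _ => ?_
  ring

lemma rho_nonneg (S : ι → 𝓢(E3, ℝ)) (x : E3) : 0 ≤ rho S x := by
  rw [rho_apply]; positivity

lemma gD_nonneg (S : ι → 𝓢(E3, ℝ)) (x : E3) : 0 ≤ gD S x := by
  rw [gD_apply]; positivity

/-- vector field for the two-body lemma -/
def FF (a δ : ℝ) (l : Fin 3) (z : E3) : ℝ := a * (1 + rx a δ z / 2) * rc δ l z

/-- its diagonal derivative -/
def FF' (a δ : ℝ) (l : Fin 3) (z : E3) : ℝ :=
  a * (1 + rx a δ z / 2) * rw_ δ z +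
    (- a ^ 2 * rx a δ z / 2 - a * (1 + rx a δ z / 2) * rw_ δ z) * rc δ l z ^ 2

lemma FF_BC {a δ : ℝ} (ha : 0 < a) (hδ : 0 < δ) (l : Fin 3) : BC (FF a δ l) := by
  have h := ((BC.const a).mul ((BC.const 1).add ((rx_BC ha hδ).mul (BC.const (1/2))))).mul
    (rc_BC hδ l)
  refine cast (congrArg BC ?_) h
  ext z; simp only [FF]; ring

lemma FF'_BC {a δ : ℝ} (ha : 0 < a) (hδ : 0 < δ) (l : Fin 3) : BC (FF' a δ l) := by
  have h0 := ((BC.const a).mul ((BC.const 1).add ((rx_BC ha hδ).mul (BC.const (1/2))))).mul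
    (rw_BC hδ)
  have h := h0.add ((((BC.const (-a^2/2)).mul (rx_BC ha hδ)).sub h0).mul ((rc_BC hδ l).pow 2))
  refine cast (congrArg BC ?_) h
  ext z; simp only [FF']; ring

lemma FF_line {a δ : ℝ} (hδ : 0 < δ) (l : Fin 3) (z : E3) :
    HasLineDerivAt ℝ (FF a δ l) (FF' a δ l z) z (ee l) := by
  have h1 := rx_line (a := a) hδ z l
  have h2 := rc_line hδ z l
  unfold HasLineDerivAt at h1 h2 ⊢
  have h3 := ((((h1.div_const 2).const_add 1).const_mul a).mul h2)
  refine HasDerivAt.congr_deriv h3 ?_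
  simp [FF']
  ring

lemma FF_ineq {a δ : ℝ} (ha : 0 < a) (hδ : 0 < δ) (z : E3) :
    3 * a * (rx a δ z * rw_ δ z) - a ^ 2 ≤ ∑ l, FF' a δ l z - ∑ l, FF a δ l z ^ 2 := by
  have hs := sr_pos hδ z
  have hq := rc_sum hδ z
  have e1 : ∑ l, FF' a δ l z = 3 * (a * (1 + rx a δ z / 2) * rw_ δ z) +
    (- a ^ 2 * rx a δ z / 2 - a * (1 + rx a δ z / 2) * rw_ δ z) * ∑ l, rc δ l z ^ 2 := by
    simp only [FF', Finset.sum_add_distrib, Finset.mul_sum]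
    simp
  have e2 : ∑ l, FF a δ l z ^ 2 = (a * (1 + rx a δ z / 2)) ^ 2 * ∑ l, rc δ l z ^ 2 := by
    simp only [FF, mul_pow, Finset.mul_sum]
  have hx : 0 < rx a δ z := Real.exp_pos _
  have hw : 0 < rw_ δ z := inv_pos.2 hs
  have hx1 : rx a δ z * (1 + a * sr δ z) ≤ 1 := by
    have h := Real.add_one_le_exp (a * sr δ z)
    have h2 : rx a δ z * Real.exp (a * sr δ z) = 1 := by
      rw [rx, ← Real.exp_add]; simp
    nlinarith
  have hws : rw_ δ z * sr δ z = 1 := inv_mul_cancel₀ hs.ne'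
  rw [e1, e2, hq]
  set x := rx a δ z
  set w := rw_ δ z
  set s := sr δ z
  have hq0 : 0 ≤ δ ^ 2 * w ^ 2 := by positivity
  have key : 0 ≤ 2 * a * w * (1 - x) - a ^ 2 * (3 / 2 * x + x ^ 2 / 4) := by
    have h1 : a * x ≤ (1 - x) * w := by
      have : a * x = x * (a * s) * w := by rw [mul_assoc, mul_assoc, mul_comm s w, hws]; ring
      rw [this]
      apply mul_le_mul_of_nonneg_right _ hw.le
      linarith
    have hxx : x ≤ 1 := by nlinarith [mul_pos ha hs]
    have h2 : a * x * (3 / 2 + x / 4) ≤ (1 - x) * w * 2 := by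
      have h0 : 0 ≤ (1 - x) * w := le_trans (by positivity) h1
      calc a * x * (3 / 2 + x / 4) ≤ (1 - x) * w * (3 / 2 + x / 4) := by gcongr
        _ ≤ _ := by gcongr; linarith
    nlinarith
  have h5 : 0 ≤ (a ^ 2 * x / 2 + a * (1 + x / 2) * w) * (δ ^ 2 * w ^ 2) := by positivity
  have h6 : 0 ≤ (a * (1 + x / 2)) ^ 2 * (δ ^ 2 * w ^ 2) := by positivity
  nlinarith

lemma two_body_pt (S : ι → 𝓢(E3, ℝ)) (F : Fin 3 → ℝ) (x y : E3) :
    ∑ l, F l * (1 / 2 * (rho S x * dd l (rho S) y - dd l (rho S) x * rho S y)) ≤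
      (∑ l, F l ^ 2) * (rho S x * rho S y) + 1 / 4 * (rho S x * gD S y + gD S x * rho S y) -
        1 / 8 * ∑ l, dd l (rho S) x * dd l (rho S) y := by
  have e : ∀ l, F l * (1 / 2 * (rho S x * dd l (rho S) y - dd l (rho S) x * rho S y)) ≤
      F l ^ 2 * (rho S x * rho S y) + 1 / 4 * (rho S x * (∑ i, dd l (S i) y ^ 2) +
        (∑ i, dd l (S i) x ^ 2) * rho S y) - 1 / 8 * (dd l (rho S) x * dd l (rho S) y) := by
    intro l
    have h : 0 ≤ ∑ i, ∑ j, (F l * (S i x * S j y) -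
      1 / 2 * (S i x * dd l (S j) y - S j y * dd l (S i) x)) ^ 2 := by positivity
    have h2 : ∑ i, ∑ j, (F l * (S i x * S j y) -
      1 / 2 * (S i x * dd l (S j) y - S j y * dd l (S i) x)) ^ 2 =
      F l ^ 2 * ((∑ i, S i x ^ 2) * (∑ j, S j y ^ 2)) +
      1 / 4 * ((∑ i, S i x ^ 2) * (∑ i, dd l (S i) y ^ 2) +
        (∑ i, dd l (S i) x ^ 2) * (∑ j, S j y ^ 2))
      - 1 / 2 * ((∑ i, S i x * dd l (S i) x) * ∑ j, S j y * dd l (S j) y)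
      - F l * ((∑ i, S i x ^ 2) * (∑ j, S j y * dd l (S j) y) -
         (∑ i, S i x * dd l (S i) x) * ∑ j, S j y ^ 2) := by
      simp only [Finset.sum_mul_sum]
      simp only [Finset.mul_sum, ← Finset.sum_add_distrib,
        ← Finset.sum_sub_distrib]
      refine Finset.sum_congr rfl fun i _ => Finset.sum_congr rfl fun j _ => ?_
      ring
    rw [h2] at h
    rw [dd_rho, dd_rho, rho_apply, rho_apply]
    linarith
  have e2 := Finset.sum_le_sum fun l (_ : l ∈ Finset.univ) => e l
  refine e2.trans (le_of_eq ?_)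
  have hg : ∀ x, gD S x = ∑ l, ∑ i, dd l (S i) x ^ 2 := fun x => by
    rw [gD_apply, Finset.sum_comm]
  rw [hg, hg]
  simp only [Finset.sum_add_distrib, Finset.sum_sub_distrib, ← Finset.mul_sum, ← Finset.sum_mul]

lemma two_body (S : ι → 𝓢(E3, ℝ)) {a δ : ℝ} (ha : 0 < a) (hδ : 0 < δ) :
    II (fun z => rx a δ z * rw_ δ z) (rho S) (rho S) ≤
      1 / (3 * a) * (1 / 2 * (∫ x, gD S x) * (∫ x, rho S x) + a ^ 2 * (∫ x, rho S x) ^ 2) := by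
  have hK : BC (fun z => rx a δ z * rw_ δ z) := (rx_BC ha hδ).mul (rw_BC hδ)
  have h1 : ∀ l, II (FF' a δ l) (rho S) (rho S) =
      1 / 2 * II (FF a δ l) (rho S) (dd l (rho S)) - 1 / 2 * II (FF a δ l) (dd l (rho S)) (rho S) := by
    intro l
    rw [II_dd1 l (FF_BC ha hδ l) (FF'_BC ha hδ l) (FF_line hδ l),
      II_dd2 l (FF_BC ha hδ l) (FF'_BC ha hδ l) (FF_line hδ l)]
    ring
  -- integrate the radial inequality
  have hR : 3 * a * II (fun z => rx a δ z * rw_ δ z) (rho S) (rho S) - a ^ 2 * (∫ x, rho S x) ^ 2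
      ≤ ∑ l, II (FF' a δ l) (rho S) (rho S) - II (fun z => ∑ l, FF a δ l z ^ 2) (rho S) (rho S) := by
    have hF2 : BC (fun z => ∑ l, FF a δ l z ^ 2) := BC.sum _ fun l => (FF_BC ha hδ l).pow 2
    rw [sq (∫ x, rho S x), ← II_one]
    unfold II
    rw [← integral_const_mul, ← integral_const_mul, ← integral_sub, ← integral_finsetSum,
      ← integral_sub]
    · apply integral_mono
      · exact ((II_int hK _ _).const_mul _).sub ((II_int (BC.const 1) _ _).const_mul _)
      · exact (integrable_finsetSum _ fun l _ => II_int (FF'_BC ha hδ l) _ _).sub (II_int hF2 _ _)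
      · intro p
        have h := FF_ineq ha hδ (p.1 - p.2)
        have h2 : 0 ≤ rho S p.1 * rho S p.2 := mul_nonneg (rho_nonneg _ _) (rho_nonneg _ _)
        have h3 := mul_le_mul_of_nonneg_right h h2
        simp only [← Finset.sum_mul]
        linarith
    · exact integrable_finsetSum _ fun l _ => II_int (FF'_BC ha hδ l) _ _
    · exact II_int hF2 _ _
    · exact fun l _ => II_int (FF'_BC ha hδ l) _ _
    · exact (II_int hK _ _).const_mul _
    · exact (II_int (BC.const 1) _ _).const_mul _
  have hP : ∑ l, II (FF' a δ l) (rho S) (rho S) ≤ II (fun z => ∑ l, FF a δ l z ^ 2) (rho S) (rho S)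
      + 1 / 2 * (∫ x, gD S x) * (∫ x, rho S x) := by
    have hF2 : BC (fun z => ∑ l, FF a δ l z ^ 2) := BC.sum _ fun l => (FF_BC ha hδ l).pow 2
    have e : 1 / 2 * (∫ x, gD S x) * (∫ x, rho S x) =
       1 / 4 * (II (fun _ => 1) (rho S) (gD S) + II (fun _ => 1) (gD S) (rho S))
        - 1 / 8 * ∑ l, II (fun _ => 1) (dd l (rho S)) (dd l (rho S)) := by
      simp only [II_one, int_dd]
      simp
      ring
    rw [e]
    simp only [h1]
    have i1 := fun l => (II_int (FF_BC ha hδ l) (rho S) (dd l (rho S)))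
    have i2 := fun l => (II_int (FF_BC ha hδ l) (dd l (rho S)) (rho S))
    have i3 := II_int hF2 (rho S) (rho S)
    have i4 := II_int (BC.const 1) (rho S) (gD S)
    have i5 := II_int (BC.const 1) (gD S) (rho S)
    have i6 := fun l => II_int (BC.const 1) (dd l (rho S)) (dd l (rho S))
    have j1 : ∀ l, Integrable (fun p : E3 × E3 =>
        1 / 2 * (FF a δ l (p.1 - p.2) * (rho S p.1 * dd l (rho S) p.2)) -
        1 / 2 * (FF a δ l (p.1 - p.2) * (dd l (rho S) p.1 * rho S p.2))) := fun l =>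
      ((i1 l).const_mul _).sub ((i2 l).const_mul _)
    have L : ∑ l, (1 / 2 * II (FF a δ l) (rho S) (dd l (rho S)) -
        1 / 2 * II (FF a δ l) (dd l (rho S)) (rho S)) = ∫ p : E3 × E3, ∑ l,
         (1 / 2 * (FF a δ l (p.1 - p.2) * (rho S p.1 * dd l (rho S) p.2)) -
        1 / 2 * (FF a δ l (p.1 - p.2) * (dd l (rho S) p.1 * rho S p.2))) := by
      rw [integral_finsetSum _ fun l _ => j1 l]
      refine Finset.sum_congr rfl fun l _ => ?_
      rw [integral_sub ((i1 l).const_mul _) ((i2 l).const_mul _), integral_const_mul,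
        integral_const_mul]
      rfl
    have j6 : Integrable (fun p : E3 × E3 => ∑ l, 1 * (dd l (rho S) p.1 * dd l (rho S) p.2)) :=
      integrable_finsetSum _ fun l _ => i6 l
    have j4 : Integrable (fun p : E3 × E3 =>
        1 / 4 * (1 * (rho S p.1 * gD S p.2) + 1 * (gD S p.1 * rho S p.2))) :=
      (i4.add i5).const_mul _
    have j7 : Integrable (fun p : E3 × E3 =>
        1 / 4 * (1 * (rho S p.1 * gD S p.2) + 1 * (gD S p.1 * rho S p.2)) -
        1 / 8 * ∑ l, 1 * (dd l (rho S) p.1 * dd l (rho S) p.2)) := j4.sub (j6.const_mul _)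
    have R : II (fun z => ∑ l, FF a δ l z ^ 2) (rho S) (rho S) +
       (1 / 4 * (II (fun _ => 1) (rho S) (gD S) + II (fun _ => 1) (gD S) (rho S))
        - 1 / 8 * ∑ l, II (fun _ => 1) (dd l (rho S)) (dd l (rho S))) =
        ∫ p : E3 × E3, ((∑ l, FF a δ l (p.1 - p.2) ^ 2) * (rho S p.1 * rho S p.2) +
         (1 / 4 * (1 * (rho S p.1 * gD S p.2) + 1 * (gD S p.1 * rho S p.2)) -
        1 / 8 * ∑ l, 1 * (dd l (rho S) p.1 * dd l (rho S) p.2))) := by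
      rw [integral_add i3 j7, integral_sub j4 (j6.const_mul _), integral_const_mul,
        integral_const_mul]
      rw [integral_add i4 i5, integral_finsetSum _ fun l _ => i6 l]
      rfl
    rw [L, R]
    apply integral_mono (integrable_finsetSum _ fun l _ => j1 l)
      (i3.add j7)
    intro p
    have h := two_body_pt S (fun l => FF a δ l (p.1 - p.2)) p.1 p.2
    simp only [one_mul]
    refine (le_of_eq ?_).trans (h.trans (le_of_eq (by
      simp only [Pi.add_apply]; ring)))
    refine Finset.sum_congr rfl fun l _ => ?_
    ring
  have h7 := hR.trans (sub_le_sub_right hP _)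
  rw [div_mul_eq_mul_div, one_mul, le_div_iff₀ (by positivity)]
  linarith

end NS


namespace NS

open LineDeriv in
lemma screened_C {a : ℝ} (ha : 0 < a) (f : 𝓢(E3, ℂ)) :
    ∃ φ : 𝓢(E3, ℂ), (a ^ 2) • φ - ∑ l : Fin 3, ∂_{ee l} (∂_{ee l} φ) = f := by
  set g : E3 → ℝ := fun ξ => (a ^ 2 + (2 * π) ^ 2 * ‖ξ‖ ^ 2)⁻¹ with hgdef
  have hgT : g.HasTemperateGrowth := by
    have h1 : (fun x : E3 => (1 + ‖(2 * π / a) • x‖ ^ 2) ^ (-1 : ℝ)).HasTemperateGrowth :=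
      (Function.hasTemperateGrowth_one_add_norm_sq_rpow (H := E3) (-1)).comp (f := fun x : E3 => (2 * π / a) • x)
        (by fun_prop)
    have h2 : (fun x : E3 => (a ^ 2)⁻¹ * (1 + ‖(2 * π / a) • x‖ ^ 2) ^ (-1 : ℝ)).HasTemperateGrowth :=
      (Function.HasTemperateGrowth.const _).mul h1
    convert h2 using 2 with x
    rw [Real.rpow_neg_one, ← mul_inv, norm_smul, hgdef]
    have : 0 < 2 * π / a := by positivity
    rw [Real.norm_of_nonneg this.le]
    field_simp
  refine ⟨fourierMultiplierCLM ℂ g f, ?_⟩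
  have hlap : ∑ l : Fin 3, ∂_{ee l} (∂_{ee l} (fourierMultiplierCLM ℂ g f)) =
      Laplacian.laplacian (fourierMultiplierCLM ℂ g f) := by
    rw [laplacian_eq_sum (EuclideanSpace.basisFun (Fin 3) ℝ)]
    simp [ee]
  have hn : (fun ξ : E3 => ‖ξ‖ ^ 2).HasTemperateGrowth := Function.hasTemperateGrowth_norm_sq E3
  rw [hlap, laplacian_eq_fourierMultiplierCLM,
    fourierMultiplierCLM_fourierMultiplierCLM_apply hn hgT]
  have hs := fourierMultiplierCLM_sum (𝕜 := ℝ) (E := E3) ℂ (s := (Finset.univ : Finset (Fin 2)))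
    (g := ![(a ^ 2) • g, ((2 * π) ^ 2) • ((fun ξ : E3 => ‖ξ‖ ^ 2) * g)]) (by
      intro i _
      fin_cases i
      · exact (Function.HasTemperateGrowth.const (a ^ 2)).mul hgT
      · exact (Function.HasTemperateGrowth.const ((2 * π) ^ 2)).mul (hn.mul hgT))
  have he : (fun x => ∑ i : Fin 2, (![(a ^ 2) • g, ((2 * π) ^ 2) • ((fun ξ : E3 => ‖ξ‖ ^ 2) * g)] : Fin 2 → E3 → ℝ) i x) =
      fun _ : E3 => (1 : ℝ) := by
    ext x
    simp only [Fin.sum_univ_two, Matrix.cons_val_zero, Matrix.cons_val_one, Pi.smul_apply, Pi.mul_apply, hgdef, smul_eq_mul]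
    have : 0 < a ^ 2 + (2 * π) ^ 2 * ‖x‖ ^ 2 := by positivity
    field_simp
  rw [he, fourierMultiplierCLM_const] at hs
  have hs2 := congrArg (fun L => L f) hs
  simp only [Fin.sum_univ_two, Matrix.cons_val_zero, Matrix.cons_val_one] at hs2
  rw [fourierMultiplierCLM_smul hgT, fourierMultiplierCLM_smul (hn.mul hgT)] at hs2
  simp at hs2
  rw [neg_smul, sub_neg_eq_add]
  refine Eq.trans ?_ hs2.symm
  ext x
  simp

lemma screened {a : ℝ} (ha : 0 < a) (f : 𝓢(E3, ℝ)) :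
    ∃ ψ : 𝓢(E3, ℝ), ∀ x, f x = a ^ 2 * ψ x - ∑ l, dd l (dd l ψ) x := by
  obtain ⟨φ, hφ⟩ := screened_C ha (f.postcompCLM Complex.ofRealCLM)
  have key : ∀ (l : Fin 3) (h : 𝓢(E3, ℂ)),
      dd l (h.postcompCLM Complex.reCLM) = (LineDeriv.lineDerivOp (ee l) h).postcompCLM Complex.reCLM := by
    intro l h
    ext x
    have h1 : HasFDerivAt (fun y => Complex.reCLM (h y)) (Complex.reCLM.comp (fderiv ℝ h x)) x :=
      Complex.reCLM.hasFDerivAt.comp x (h.hasFDerivAt x)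
    have h2 : dd l (h.postcompCLM Complex.reCLM) x = fderiv ℝ (fun y => Complex.reCLM (h y)) x (ee l) := rfl
    rw [h2, h1.fderiv]
    rfl
  refine ⟨φ.postcompCLM Complex.reCLM, fun x => ?_⟩
  have h3 := congrArg (fun k : 𝓢(E3, ℂ) => (k x).re) hφ
  simp only [key]
  simp at h3
  have h4 : ((a : ℂ) ^ 2) = ((a ^ 2 : ℝ) : ℂ) := by push_cast; rfl
  rw [h4, Complex.ofReal_re, Complex.ofReal_im] at h3
  simp [← h3]

/-- kernel derivative -/
def KK' (a δ : ℝ) (l : Fin 3) (z : E3) : ℝ :=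
  (- a * (rx a δ z * rw_ δ z) - rx a δ z * rw_ δ z ^ 2) * rc δ l z

/-- second kernel derivative -/
def KK'' (a δ : ℝ) (l : Fin 3) (z : E3) : ℝ :=
  (- a * (rx a δ z * rw_ δ z) - rx a δ z * rw_ δ z ^ 2) * rw_ δ z +
  (a ^ 2 * (rx a δ z * rw_ δ z) + 3 * a * (rx a δ z * rw_ δ z ^ 2) + 3 * (rx a δ z * rw_ δ z ^ 3))
    * rc δ l z ^ 2

lemma KK'_BC {a δ : ℝ} (ha : 0 < a) (hδ : 0 < δ) (l : Fin 3) : BC (KK' a δ l) := by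
  have hx := rx_BC ha hδ
  have hw := rw_BC hδ
  exact (((BC.const (-a)).mul (hx.mul hw)).sub (hx.mul (hw.pow 2))).mul (rc_BC hδ l)

lemma KK''_BC {a δ : ℝ} (ha : 0 < a) (hδ : 0 < δ) (l : Fin 3) : BC (KK'' a δ l) := by
  have hx := rx_BC ha hδ
  have hw := rw_BC hδ
  exact ((((BC.const (-a)).mul (hx.mul hw)).sub (hx.mul (hw.pow 2))).mul hw).add
    (((((BC.const (a ^ 2)).mul (hx.mul hw))).add ((BC.const (3 * a)).mul (hx.mul (hw.pow 2))) |>.add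
      ((BC.const 3).mul (hx.mul (hw.pow 3)))).mul ((rc_BC hδ l).pow 2))

lemma KK_line {a δ : ℝ} (hδ : 0 < δ) (l : Fin 3) (z : E3) :
    HasLineDerivAt ℝ (fun z => rx a δ z * rw_ δ z) (KK' a δ l z) z (ee l) := by
  have h1 := rx_line (a := a) hδ z l
  have h2 := rw_line hδ z l
  unfold HasLineDerivAt at h1 h2 ⊢
  refine HasDerivAt.congr_deriv (h1.mul h2) ?_
  simp [KK']
  ring

lemma KK'_line {a δ : ℝ} (hδ : 0 < δ) (l : Fin 3) (z : E3) :
    HasLineDerivAt ℝ (KK' a δ l) (KK'' a δ l z) z (ee l) := by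
  have h1 := rx_line (a := a) hδ z l
  have h2 := rw_line hδ z l
  have h3 := rc_line hδ z l
  unfold HasLineDerivAt at h1 h2 h3 ⊢
  refine HasDerivAt.congr_deriv ((((h1.mul h2).const_mul (-a)).sub (h1.mul (h2.pow 2))).mul h3) ?_
  simp [KK'']
  ring

/-- approximate identity -/
def eta (a δ : ℝ) (z : E3) : ℝ :=
  δ ^ 2 * rx a δ z * rw_ δ z ^ 3 * (a ^ 2 + 3 * a * rw_ δ z + 3 * rw_ δ z ^ 2)

lemma eta_eq {a δ : ℝ} (hδ : 0 < δ) (z : E3) :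
    a ^ 2 * (rx a δ z * rw_ δ z) - ∑ l, KK'' a δ l z = eta a δ z := by
  have h : ∑ l, KK'' a δ l z =
    3 * ((- a * (rx a δ z * rw_ δ z) - rx a δ z * rw_ δ z ^ 2) * rw_ δ z) +
    (a ^ 2 * (rx a δ z * rw_ δ z) + 3 * a * (rx a δ z * rw_ δ z ^ 2) + 3 * (rx a δ z * rw_ δ z ^ 3))
    * ∑ l, rc δ l z ^ 2 := by
    simp only [KK'', Finset.sum_add_distrib, ← Finset.mul_sum]
    simp
    ring
  rw [h, rc_sum hδ, eta]
  ring

lemma eta_BC {a δ : ℝ} (ha : 0 < a) (hδ : 0 < δ) : BC (eta a δ) := by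
  have hx := rx_BC ha hδ
  have hw := rw_BC hδ
  exact (((BC.const (δ ^ 2)).mul hx).mul (hw.pow 3)).mul (((BC.const (a ^ 2)).add
    ((BC.const (3 * a)).mul hw)).add ((BC.const 3).mul (hw.pow 2)))

lemma conv_eta {a δ : ℝ} (ha : 0 < a) (hδ : 0 < δ) (f ψ : 𝓢(E3, ℝ))
    (h : ∀ x, f x = a ^ 2 * ψ x - ∑ l, dd l (dd l ψ) x) (x : E3) :
    ∫ y, (rx a δ (x - y) * rw_ δ (x - y)) * f y = ∫ y, eta a δ (x - y) * ψ y := by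
  have hK : BC (fun z => rx a δ z * rw_ δ z) := (rx_BC ha hδ).mul (rw_BC hδ)
  have hl : ∀ l, ∫ y, (rx a δ (x - y) * rw_ δ (x - y)) * dd l (dd l ψ) y =
      ∫ y, KK'' a δ l (x - y) * ψ y := fun l => by
    rw [conv_dd l hK (KK'_BC ha hδ l) (KK_line hδ l),
      conv_dd l (KK'_BC ha hδ l) (KK''_BC ha hδ l) (KK'_line hδ l)]
  have i1 := (hK.shift' x).int ψ
  have i2 := fun l => (hK.shift' x).int (dd l (dd l ψ))
  have i3 := fun l => ((KK''_BC ha hδ l).shift' x).int ψ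
  simp only [h, ← eta_eq hδ]
  have e1 : ∀ y, (rx a δ (x - y) * rw_ δ (x - y)) * (a ^ 2 * ψ y - ∑ l, dd l (dd l ψ) y) =
      a ^ 2 * ((rx a δ (x - y) * rw_ δ (x - y)) * ψ y) -
        ∑ l, (rx a δ (x - y) * rw_ δ (x - y)) * dd l (dd l ψ) y := fun y => by
    rw [← Finset.mul_sum]; ring
  have e2 : ∀ y, (a ^ 2 * (rx a δ (x - y) * rw_ δ (x - y)) - ∑ l, KK'' a δ l (x - y)) * ψ y =
      a ^ 2 * ((rx a δ (x - y) * rw_ δ (x - y)) * ψ y) - ∑ l, KK'' a δ l (x - y) * ψ y := fun y => by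
    rw [← Finset.sum_mul]; ring
  simp only [e1, e2]
  rw [integral_sub (i1.const_mul _) (integrable_finsetSum _ fun l _ => i2 l),
    integral_sub (i1.const_mul _) (integrable_finsetSum _ fun l _ => i3 l),
    integral_finsetSum _ fun l _ => i2 l, integral_finsetSum _ fun l _ => i3 l]
  simp only [hl]

lemma sr_scale {δ : ℝ} (hδ : 0 < δ) (w : E3) : sr δ (δ • w) = δ * sr 1 w := by
  unfold sr
  rw [norm_smul, Real.norm_of_nonneg hδ.le]
  rw [show (δ * ‖w‖) ^ 2 + δ ^ 2 = δ ^ 2 * (‖w‖ ^ 2 + 1 ^ 2) by ring, Real.sqrt_mul (by positivity),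
    Real.sqrt_sq hδ.le]

/-- profile -/
def th (t : ℝ) : ℝ := Real.exp (-t) * (t ^ 2 + 3 * t + 3)

lemma th_nonneg {t : ℝ} (ht : 0 ≤ t) : 0 ≤ th t := by unfold th; positivity

lemma th_le {t : ℝ} (ht : 0 ≤ t) : th t ≤ 3 := by
  have h := Real.quadratic_le_exp_of_nonneg ht
  have h2 : t ^ 2 + 3 * t + 3 ≤ 3 * Real.exp t := by nlinarith [sq_nonneg t]
  unfold th
  calc Real.exp (-t) * (t ^ 2 + 3 * t + 3) ≤ Real.exp (-t) * (3 * Real.exp t) := by gcongr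
    _ = 3 * (Real.exp (-t) * Real.exp t) := by ring
    _ = 3 := by rw [← Real.exp_add]; simp

lemma eta_scale {a δ : ℝ} (hδ : 0 < δ) (w : E3) :
    δ ^ 3 * eta a δ (δ • w) = th (a * δ * sr 1 w) * rw_ 1 w ^ 5 := by
  have hs := sr_pos one_pos w
  simp only [eta, rx, rw_, sr_scale hδ, th]
  rw [show -a * (δ * sr 1 w) = -(a * δ * sr 1 w) by ring]
  field_simp

lemma eta_conv {a δ : ℝ} (hδ : 0 < δ) (ψ : 𝓢(E3, ℝ)) (x : E3) :
    ∫ y, eta a δ (x - y) * ψ y = ∫ w, th (a * δ * sr 1 w) * rw_ 1 w ^ 5 * ψ (x - δ • w) := by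
  have h1 : ∫ y, eta a δ (x - y) * ψ y = ∫ y, eta a δ y * ψ (x - y) := by
    rw [← integral_sub_left_eq_self (fun y => eta a δ y * ψ (x - y)) volume x]
    simp
  have h2 := Measure.integral_comp_smul (volume : Measure E3) (fun y => eta a δ y * ψ (x - y)) δ
  simp only [← eta_scale hδ]
  simp only [mul_assoc]
  rw [integral_const_mul, h2, h1]
  simp
  rw [abs_of_pos hδ]
  field_simp

lemma int_sigma : Integrable (fun w : E3 => rw_ 1 w ^ 5) ∧ ∫ w : E3, rw_ 1 w ^ 5 = 4 * π / 3 := by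
  have hrad : ∀ w : E3, rw_ 1 w ^ 5 = (fun r : ℝ => (√(r ^ 2 + 1))⁻¹ ^ 5) ‖w‖ := fun w => by
    simp [rw_, sr]
  have hd : ∀ r ∈ Set.Ici (0:ℝ), HasDerivAt (fun r : ℝ => (r * (√(r ^ 2 + 1))⁻¹) ^ 3 / 3)
      (r ^ 2 * (√(r ^ 2 + 1))⁻¹ ^ 5) r := by
    intro r _
    have hp : 0 < r ^ 2 + 1 := by positivity
    have h1 : HasDerivAt (fun r : ℝ => r ^ 2 + 1) (2 * r) r := by
      simpa using (hasDerivAt_pow 2 r).add_const (1:ℝ)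
    have h2 := h1.sqrt hp.ne'
    have h3 := (((hasDerivAt_id r).mul (h2.inv (Real.sqrt_pos.2 hp).ne')).pow 3).div_const 3
    refine HasDerivAt.congr_deriv h3 ?_
    have hs := Real.sqrt_pos.2 hp
    have hq := Real.sq_sqrt hp.le
    simp
    generalize √(r ^ 2 + 1) = s at *
    field_simp
    rw [hq]; ring
  have hpos : ∀ r ∈ Set.Ioi (0:ℝ), 0 ≤ r ^ 2 * (√(r ^ 2 + 1))⁻¹ ^ 5 := fun r _ => by positivity
  have hlim : Filter.Tendsto (fun r : ℝ => (r * (√(r ^ 2 + 1))⁻¹) ^ 3 / 3) Filter.atTop (nhds (1 / 3)) := by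
    have h1 : Filter.Tendsto (fun r : ℝ => r * (√(r ^ 2 + 1))⁻¹) Filter.atTop (nhds 1) := by
      have h2 : Filter.Tendsto (fun r : ℝ => (√(1 + (r ^ 2)⁻¹))⁻¹) Filter.atTop (nhds (√(1 + 0))⁻¹) := by
        refine Filter.Tendsto.inv₀ ?_ (by simp)
        refine (Real.continuous_sqrt.tendsto _).comp ?_
        exact tendsto_const_nhds.add (tendsto_inv_atTop_zero.comp (Filter.tendsto_pow_atTop two_ne_zero))
      simp only [add_zero, Real.sqrt_one, inv_one] at h2
      refine h2.congr' ?_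
      filter_upwards [Filter.eventually_gt_atTop 0] with r hr
      rw [show r ^ 2 + 1 = r ^ 2 * (1 + (r ^ 2)⁻¹) by field_simp, Real.sqrt_mul (by positivity),
        Real.sqrt_sq hr.le]
      field_simp
    have := (h1.pow 3).div_const 3
    simpa using this
  have hintg := integrableOn_Ioi_deriv_of_nonneg' hd hpos hlim
  have hval := integral_Ioi_of_hasDerivAt_of_nonneg' hd hpos hlim
  have hintg' := (integrable_fun_norm_addHaar (E := E3) (F := ℝ) volume (f := fun r : ℝ => (√(r ^ 2 + 1))⁻¹ ^ 5)).2
    (by simpa using hintg)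
  simp only [hrad]
  refine ⟨hintg', ?_⟩
  rw [integral_fun_norm_addHaar (E := E3) (F := ℝ) volume (fun r : ℝ => (√(r ^ 2 + 1))⁻¹ ^ 5)]
  have e : ∫ y in Set.Ioi (0:ℝ), y ^ (Module.finrank ℝ E3 - 1) • (√(y ^ 2 + 1))⁻¹ ^ 5 = 1 / 3 := by
    simp only [finrank_euclideanSpace, Fintype.card_fin, smul_eq_mul]
    rw [show (3 - 1 : ℕ) = 2 from rfl, hval]
    simp
  rw [e]
  have hv : (volume : Measure E3).real (Metric.ball 0 1) = 4 * π / 3 := by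
    rw [Measure.real, EuclideanSpace.volume_ball_fin_three]
    simp
    rw [ENNReal.toReal_ofReal (by positivity)]
    ring
  rw [hv]
  simp
  ring

end NS


namespace NS

open Filter Topology in
lemma lim_pot {a : ℝ} (ha : 0 < a) (f ψ : 𝓢(E3, ℝ))
    (h : ∀ x, f x = a ^ 2 * ψ x - ∑ l, dd l (dd l ψ) x) {C : ℝ}
    (hC : ∀ δ > 0, II (fun z => rx a δ z * rw_ δ z) f f ≤ C) :
    4 * π * ∫ x, f x * ψ x ≤ C := by
  obtain ⟨Cψ, hC0, hCψ⟩ := sch_bdd ψ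
  set J : ℝ → E3 → ℝ := fun δ x => ∫ w, th (a * δ * sr 1 w) * rw_ 1 w ^ 5 * ψ (x - δ • w) with hJ
  have hs1 : ∀ w, 0 < sr 1 w := fun w => sr_pos one_pos w
  have hw1 : ∀ w, 0 < rw_ 1 w := fun w => inv_pos.2 (hs1 w)
  have hbd : ∀ δ > 0, ∀ x w, ‖th (a * δ * sr 1 w) * rw_ 1 w ^ 5 * ψ (x - δ • w)‖ ≤
      3 * Cψ * rw_ 1 w ^ 5 := by
    intro δ hδ x w
    have := hs1 w
    have hw := hw1 w
    have ht : 0 ≤ a * δ * sr 1 w := by positivity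
    rw [norm_mul, norm_mul, Real.norm_of_nonneg (th_nonneg ht), Real.norm_of_nonneg (by positivity),
      Real.norm_eq_abs]
    calc _ ≤ 3 * rw_ 1 w ^ 5 * Cψ := by
          have := th_le ht
          have := hCψ (x - δ • w)
          gcongr
      _ = _ := by ring
  have hbi : Integrable (fun w : E3 => 3 * Cψ * rw_ 1 w ^ 5) := int_sigma.1.const_mul _
  have hJlim : ∀ x, Tendsto (fun δ => J δ x) (𝓝[>] 0) (𝓝 (4 * π * ψ x)) := by
    intro x
    have e : 4 * π * ψ x = ∫ w : E3, 3 * rw_ 1 w ^ 5 * ψ x := by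
      rw [integral_mul_const, integral_const_mul, int_sigma.2]; ring
    rw [e]
    refine tendsto_integral_filter_of_dominated_convergence _ ?_ ?_ hbi ?_
    · refine Eventually.of_forall fun δ => Continuous.aestronglyMeasurable ?_
      have h1 := sr_cont 1
      have h2 := rw_cont one_pos
      have h3 := ψ.continuous
      unfold th
      fun_prop
    · filter_upwards [self_mem_nhdsWithin] with δ hδ
      exact Eventually.of_forall fun w => hbd δ hδ x w
    · refine Eventually.of_forall fun w => ?_
      have hc : Continuous (fun δ : ℝ => th (a * δ * sr 1 w) * rw_ 1 w ^ 5 * ψ (x - δ • w)) := by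
        have h3 := ψ.continuous
        unfold th
        fun_prop
      have := hc.tendsto 0
      simp [th] at this
      exact this.mono_left nhdsWithin_le_nhds
  have hII : ∀ δ > 0, II (fun z => rx a δ z * rw_ δ z) f f = ∫ x, f x * J δ x := by
    intro δ hδ
    rw [II_eq ((rx_BC ha hδ).mul (rw_BC hδ))]
    congr 1; ext x
    rw [conv_eta ha hδ f ψ h, eta_conv hδ]
  have hmeas : ∀ δ > 0, AEStronglyMeasurable (fun x => f x * J δ x) volume := by
    intro δ hδ
    have hK := (rx_BC ha hδ).mul (rw_BC hδ)
    have h1 := (II_int hK f f).integral_prod_left.aestronglyMeasurable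
    refine h1.congr (Eventually.of_forall fun x => ?_)
    simp only [hJ]
    rw [← eta_conv hδ, ← conv_eta ha hδ f ψ h, ← integral_const_mul]
    congr 1; ext y; ring
  have hlim : Tendsto (fun δ => ∫ x, f x * J δ x) (𝓝[>] 0) (𝓝 (∫ x, f x * (4 * π * ψ x))) := by
    refine tendsto_integral_filter_of_dominated_convergence
      (fun x => ‖f x‖ * ∫ w : E3, 3 * Cψ * rw_ 1 w ^ 5) ?_ ?_ ?_ ?_
    · filter_upwards [self_mem_nhdsWithin] with δ hδ using hmeas δ hδ
    · filter_upwards [self_mem_nhdsWithin] with δ hδ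
      refine Eventually.of_forall fun x => ?_
      rw [norm_mul]
      gcongr
      exact norm_integral_le_of_norm_le hbi (Eventually.of_forall fun w => hbd δ hδ x w)
    · exact f.integrable.norm.mul_const _
    · exact Eventually.of_forall fun x => (hJlim x).const_mul _
  have hfin : ∫ x, f x * (4 * π * ψ x) ≤ C := by
    refine le_of_tendsto hlim ?_
    filter_upwards [self_mem_nhdsWithin] with δ hδ
    rw [← hII δ hδ]
    exact hC δ hδ
  rw [← integral_const_mul]
  refine (le_of_eq ?_).trans hfin
  congr 1; ext x; ring

variable {ι : Type*} [Fintype ι]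

/-- smoothed modulus -/
def fe (S : ι → 𝓢(E3, ℝ)) (ε : ℝ) (x : E3) : ℝ := √(rho S x + ε ^ 2) - ε
/-- its partial derivative -/
def fe' (S : ι → 𝓢(E3, ℝ)) (ε : ℝ) (l : Fin 3) (x : E3) : ℝ :=
  dd l (rho S) x / (2 * √(rho S x + ε ^ 2))

lemma fe_line (S : ι → 𝓢(E3, ℝ)) {ε : ℝ} (hε : 0 < ε) (l : Fin 3) (x : E3) :
    HasLineDerivAt ℝ (fe S ε) (fe' S ε l x) x (ee l) := by
  have h1 := dd_line l (rho S) x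
  unfold HasLineDerivAt at h1 ⊢
  have h0 := rho_nonneg S x
  have h2 := ((h1.add_const (ε ^ 2)).sqrt (by simp; positivity)).sub_const ε
  refine HasDerivAt.congr_deriv h2 ?_
  simp [fe']

lemma fe_nonneg (S : ι → 𝓢(E3, ℝ)) {ε : ℝ} (_hε : 0 < ε) (x : E3) : 0 ≤ fe S ε x := by
  have h0 := rho_nonneg S x
  have : ε ≤ √(rho S x + ε ^ 2) := Real.le_sqrt_of_sq_le (by linarith)
  unfold fe; linarith

lemma fe_le (S : ι → 𝓢(E3, ℝ)) {ε : ℝ} (hε : 0 < ε) (x : E3) : fe S ε x ≤ √(rho S x) := by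
  have h0 := rho_nonneg S x
  have h1 : √(rho S x + ε ^ 2) ≤ √(rho S x) + ε := by
    apply Real.sqrt_le_iff.2
    refine ⟨by positivity, ?_⟩
    nlinarith [Real.sq_sqrt h0, Real.sqrt_nonneg (rho S x)]
  unfold fe; linarith

lemma fe_ge (S : ι → 𝓢(E3, ℝ)) (ε : ℝ) (x : E3) : √(rho S x) - ε ≤ fe S ε x := by
  have : √(rho S x) ≤ √(rho S x + ε ^ 2) := Real.sqrt_le_sqrt (by nlinarith [sq_nonneg ε])
  unfold fe; linarith

lemma sqrt_rho_BC (S : ι → 𝓢(E3, ℝ)) : BC (fun x => √(rho S x)) := by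
  obtain ⟨C, h0, hC⟩ := sch_bdd (rho S)
  refine ⟨Real.continuous_sqrt.comp (rho S).continuous, √C, fun x => ?_⟩
  rw [abs_of_nonneg (Real.sqrt_nonneg _)]
  exact Real.sqrt_le_sqrt ((le_abs_self _).trans (hC x))

lemma fe_BC (S : ι → 𝓢(E3, ℝ)) {ε : ℝ} (hε : 0 < ε) : BC (fe S ε) := by
  obtain ⟨h1, C, h2⟩ := sqrt_rho_BC S
  have := (rho S).continuous
  refine ⟨by unfold fe; fun_prop, C, fun x => ?_⟩
  rw [abs_of_nonneg (fe_nonneg S hε x)]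
  exact (fe_le S hε x).trans ((le_abs_self _).trans (h2 x))

lemma fe'_sq (S : ι → 𝓢(E3, ℝ)) {ε : ℝ} (hε : 0 < ε) (x : E3) :
    ∑ l, fe' S ε l x ^ 2 ≤ gD S x := by
  rw [gD_apply, Finset.sum_comm]
  refine Finset.sum_le_sum fun l _ => ?_
  have h0 := rho_nonneg S x
  have hp : 0 < rho S x + ε ^ 2 := by positivity
  rw [fe', div_pow, mul_pow, Real.sq_sqrt hp.le, dd_rho, div_le_iff₀ (by positivity)]
  have hcs := Finset.sum_mul_sq_le_sq_mul_sq Finset.univ (fun i => S i x) (fun i => dd l (S i) x)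
  have h3 : 0 ≤ ∑ i, dd l (S i) x ^ 2 := by positivity
  rw [rho_apply]
  nlinarith [sq_nonneg ε, mul_nonneg h3 (sq_nonneg ε)]

lemma fe'_BC (S : ι → 𝓢(E3, ℝ)) {ε : ℝ} (hε : 0 < ε) (l : Fin 3) : BC (fe' S ε l) := by
  have h0 := rho_nonneg S
  obtain ⟨C, hC0, hC⟩ := sch_bdd (gD S)
  refine ⟨?_, 1 + C, fun x => ?_⟩
  · have h1 := (rho S).continuous
    have h2 := (dd l (rho S)).continuous
    unfold fe'
    refine h2.div (by fun_prop) fun x => ?_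
    have := h0 x
    positivity
  · have h1 := fe'_sq S hε x
    have h2 : fe' S ε l x ^ 2 ≤ ∑ l, fe' S ε l x ^ 2 :=
      Finset.single_le_sum (f := fun l => fe' S ε l x ^ 2) (fun i _ => sq_nonneg _) (Finset.mem_univ l)
    have h3 := (le_abs_self _).trans (hC x)
    have h4 : fe' S ε l x ^ 2 ≤ C := h2.trans (h1.trans h3)
    apply abs_le_of_sq_le_sq _ (by positivity)
    nlinarith

/-- Gagliardo–Nirenberg type inequality with free parameters. -/
lemma GN (S : ι → 𝓢(E3, ℝ)) {a τ : ℝ} (ha : 0 < a) (hτ : 0 < τ) :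
    ∫ x, √(rho S x) * rho S x ≤ τ / 2 * ((∫ x, gD S x) + a ^ 2 * ∫ x, rho S x) +
      1 / (2 * τ) * (1 / (12 * π * a) * (1 / 2 * (∫ x, gD S x) * (∫ x, rho S x)
        + a ^ 2 * (∫ x, rho S x) ^ 2)) := by
  obtain ⟨ψ, hψ⟩ := screened ha (rho S)
  have hB := lim_pot ha (rho S) ψ hψ (fun δ hδ => two_body S ha hδ)
  set A := ∫ x, gD S x
  set M := ∫ x, rho S x
  have hB' : ∫ x, rho S x * ψ x ≤ 1 / (12 * π * a) * (1 / 2 * A * M + a ^ 2 * M ^ 2) := by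
    have e : 1 / (3 * a) * (1 / 2 * A * M + a ^ 2 * M ^ 2) =
      4 * π * (1 / (12 * π * a) * (1 / 2 * A * M + a ^ 2 * M ^ 2)) := by
      field_simp; ring
    rw [e] at hB
    exact le_of_mul_le_mul_left hB (by positivity)
  have hgrad : ∫ x, (a ^ 2 * ψ x ^ 2 + ∑ l, dd l ψ x ^ 2) = ∫ x, rho S x * ψ x := by
    have i0 : Integrable (fun x => a ^ 2 * ψ x ^ 2) := by
      have := ((BC.sch ψ).int ψ).const_mul (a ^ 2)
      simpa [sq] using this
    have i1 : ∀ l, Integrable (fun x => dd l ψ x ^ 2) := fun l => by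
      simpa [sq] using (BC.sch (dd l ψ)).int (dd l ψ)
    have i2 : ∀ l, Integrable (fun x => ψ x * dd l (dd l ψ) x) := fun l =>
      (BC.sch ψ).int _
    have e : ∀ x, rho S x * ψ x = a ^ 2 * ψ x ^ 2 - ∑ l, ψ x * dd l (dd l ψ) x := fun x => by
      rw [hψ, ← Finset.mul_sum]; ring
    simp only [e]
    rw [integral_add i0 (integrable_finsetSum _ fun l _ => i1 l),
      integral_sub i0 (integrable_finsetSum _ fun l _ => i2 l),
      integral_finsetSum _ fun l _ => i1 l, integral_finsetSum _ fun l _ => i2 l]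
    simp only [fun l => int_mul_dd l ψ (dd l ψ), Finset.sum_neg_distrib]
    simp [sq]
  have main : ∀ ε > 0, ∫ x, √(rho S x) * rho S x ≤ τ / 2 * (A + a ^ 2 * M) +
      1 / (2 * τ) * (∫ x, rho S x * ψ x) + ε * M := by
    intro ε hε
    have hf := fe_BC S hε
    have hf' := fe'_BC S hε
    have s1 : ∫ x, √(rho S x) * rho S x ≤ (∫ x, fe S ε x * rho S x) + ε * M := by
      rw [← integral_const_mul, ← integral_add (hf.int _) ((rho S).integrable.const_mul _)]
      refine integral_mono ((sqrt_rho_BC S).int _) ((hf.int _).add ((rho S).integrable.const_mul _)) fun x => ?_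
      have := mul_le_mul_of_nonneg_right (fe_ge S ε x) (rho_nonneg S x)
      simp only [Pi.add_apply]
      linarith
    have s2 : ∫ x, fe S ε x * rho S x = ∫ x, (a ^ 2 * (fe S ε x * ψ x) + ∑ l, fe' S ε l x * dd l ψ x) := by
      have e : ∀ x, fe S ε x * rho S x = a ^ 2 * (fe S ε x * ψ x) - ∑ l, fe S ε x * dd l (dd l ψ) x := fun x => by
        rw [hψ, ← Finset.mul_sum]; ring
      simp only [e]
      rw [integral_sub ((hf.int ψ).const_mul _) (integrable_finsetSum _ fun l _ => hf.int (dd l (dd l ψ))),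
        integral_add ((hf.int ψ).const_mul _) (integrable_finsetSum _ fun l _ => (hf' l).int (dd l ψ)),
        integral_finsetSum _ fun l _ => (hf' l).int (dd l ψ),
        integral_finsetSum _ fun l _ => hf.int (dd l (dd l ψ))]
      simp only [fun l => BC.ibp l hf (hf' l) (fe_line S hε l) (dd l ψ), Finset.sum_neg_distrib]
      ring
    have i3 : Integrable (fun x => τ / 2 * (gD S x + a ^ 2 * rho S x)) :=
      ((gD S).integrable.add ((rho S).integrable.const_mul _)).const_mul _
    have i4 : Integrable (fun x => 1 / (2 * τ) * (a ^ 2 * ψ x ^ 2 + ∑ l, dd l ψ x ^ 2)) := by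
      refine Integrable.const_mul (Integrable.add ?_ (integrable_finsetSum _ fun l _ => ?_)) _
      · have := ((BC.sch ψ).int ψ).const_mul (a ^ 2)
        simpa [sq] using this
      · simpa [sq] using (BC.sch (dd l ψ)).int (dd l ψ)
    have s3 : ∫ x, fe S ε x * rho S x ≤ τ / 2 * (A + a ^ 2 * M) + 1 / (2 * τ) * (∫ x, rho S x * ψ x) := by
      have e : τ / 2 * (A + a ^ 2 * M) + 1 / (2 * τ) * (∫ x, rho S x * ψ x) =
          ∫ x, (τ / 2 * (gD S x + a ^ 2 * rho S x) + 1 / (2 * τ) * (a ^ 2 * ψ x ^ 2 + ∑ l, dd l ψ x ^ 2)) := by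
        rw [integral_add i3 i4, integral_const_mul, integral_const_mul, hgrad,
          integral_add (gD S).integrable ((rho S).integrable.const_mul _), integral_const_mul]
      rw [e, s2]
      refine integral_mono (((hf.int ψ).const_mul _).add
        (integrable_finsetSum _ fun l _ => (hf' l).int (dd l ψ))) (i3.add i4) fun x => ?_
      simp only [Pi.add_apply]
      have young : ∀ p q : ℝ, p * q ≤ τ / 2 * p ^ 2 + 1 / (2 * τ) * q ^ 2 := by
        intro p q
        have : τ / 2 * p ^ 2 + 1 / (2 * τ) * q ^ 2 - p * q = 1 / (2 * τ) * (τ * p - q) ^ 2 := by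
          field_simp; ring
        have h2 : 0 ≤ 1 / (2 * τ) * (τ * p - q) ^ 2 := by positivity
        linarith
      have y1 := young (fe S ε x) (ψ x)
      have y2 := Finset.sum_le_sum fun l (_ : l ∈ Finset.univ) => young (fe' S ε l x) (dd l ψ x)
      rw [Finset.sum_add_distrib, ← Finset.mul_sum, ← Finset.mul_sum] at y2
      have y3 := fe'_sq S hε x
      have y4 : fe S ε x ^ 2 ≤ rho S x := by
        have h1 := fe_nonneg S hε x
        have h2 := fe_le S hε x
        have h3 := Real.sq_sqrt (rho_nonneg S x)
        nlinarith
      have y5 := mul_le_mul_of_nonneg_left y3 (show 0 ≤ τ / 2 by positivity)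
      have y6 := mul_le_mul_of_nonneg_left y4 (show 0 ≤ a ^ 2 * (τ / 2) by positivity)
      have y7 := mul_le_mul_of_nonneg_left y1 (show 0 ≤ a ^ 2 by positivity)
      linarith
    linarith
  have hM : 0 ≤ M := integral_nonneg fun x => rho_nonneg S x
  have lim : ∫ x, √(rho S x) * rho S x ≤ τ / 2 * (A + a ^ 2 * M) +
      1 / (2 * τ) * (∫ x, rho S x * ψ x) := by
    refine le_of_forall_pos_le_add fun e he => ?_
    have := main (e / (M + 1)) (by positivity)
    have h2 : e / (M + 1) * M ≤ e := by
      rw [div_mul_eq_mul_div, div_le_iff₀ (by positivity)]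
      nlinarith
    linarith
  have := mul_le_mul_of_nonneg_left hB' (show 0 ≤ 1 / (2 * τ) by positivity)
  linarith

end NS


namespace NS

lemma det_bound (p q r x y z : ℝ) (h : p + q + r = 0) :
    54 * (p * q * r + 2 * x * y * z - p * z ^ 2 - q * y ^ 2 - r * x ^ 2) ^ 2 ≤
      (p ^ 2 + q ^ 2 + r ^ 2 + 2 * (x ^ 2 + y ^ 2 + z ^ 2)) ^ 3 := by
  set A : Matrix (Fin 3) (Fin 3) ℝ := !![p, x, y; x, q, z; y, z, r] with hAdef
  have hA : A.IsHermitian := by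
    ext i j
    fin_cases i <;> fin_cases j <;> simp [hAdef]
  have key : ∀ t : ℝ, (t - hA.eigenvalues 0) * (t - hA.eigenvalues 1) * (t - hA.eigenvalues 2) =
      (t - p) * (t - q) * (t - r) - 2 * x * y * z - (t - p) * z ^ 2 - (t - q) * y ^ 2 -
        (t - r) * x ^ 2 := by
    intro t
    have h1 := congrArg (Polynomial.eval t) hA.charpoly_eq
    rw [Matrix.eval_charpoly, Polynomial.eval_prod, Fin.prod_univ_three, Matrix.det_fin_three] at h1
    simp [hAdef] at h1
    rw [← h1]
    ring
  have k0 := key 0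
  have k1 := key 1
  have k2 := key (-1)
  set a := hA.eigenvalues 0
  set b := hA.eigenvalues 1
  set c := hA.eigenvalues 2
  have e1 : a + b + c = 0 := by linarith
  have e2 : a * b + a * c + b * c = p * q + p * r + q * r - x ^ 2 - y ^ 2 - z ^ 2 := by linarith
  have hn : p ^ 2 + q ^ 2 + r ^ 2 + 2 * (x ^ 2 + y ^ 2 + z ^ 2) = -2 * (a * b + a * c + b * c) := by
    rw [e2]
    have : r = -p - q := by linarith
    subst this
    ring
  have hd : p * q * r + 2 * x * y * z - p * z ^ 2 - q * y ^ 2 - r * x ^ 2 = a * b * c := by linarith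
  rw [hn, hd]
  have hc : c = -a - b := by linarith
  rw [hc]
  have : (-2 * (a * b + a * (-a - b) + b * (-a - b))) ^ 3 - 54 * (a * b * (-a - b)) ^ 2 =
      2 * ((a - b) * (2 * a + b) * (a + 2 * b)) ^ 2 := by ring
  have h2 : 0 ≤ 2 * ((a - b) * (2 * a + b) * (a + 2 * b)) ^ 2 := by positivity
  linarith

/-- Schwartz version of the curl -/
def W (v : Fin 3 → 𝓢(E3, ℝ)) : Fin 3 → 𝓢(E3, ℝ) :=
  ![dd 1 (v 2) - dd 2 (v 1), dd 2 (v 0) - dd 0 (v 2), dd 0 (v 1) - dd 1 (v 0)]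

lemma W_curl (v : Fin 3 → 𝓢(E3, ℝ)) (k : Fin 3) : curl (fun i => ⇑(v i)) k = ⇑(W v k) := by
  fin_cases k <;> rfl

/-- Schwartz version of the strain -/
def St (v : Fin 3 → 𝓢(E3, ℝ)) : Fin 3 × Fin 3 → 𝓢(E3, ℝ) :=
  fun p => (1 / 2 : ℝ) • (dd p.1 (v p.2) + dd p.2 (v p.1))

lemma St_apply (v : Fin 3 → 𝓢(E3, ℝ)) (i j : Fin 3) (x : E3) :
    St v (i, j) x = (dd i (v j) x + dd j (v i) x) / 2 := by
  simp [St]; ring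

lemma St_strain (v : Fin 3 → 𝓢(E3, ℝ)) (i j : Fin 3) (x : E3) :
    strain (fun i => ⇑(v i)) i j x = St v (i, j) x := by
  rw [St_apply]; rfl

/-- divergence free -/
def DF (v : Fin 3 → 𝓢(E3, ℝ)) : Prop := ∑ i, dd i (v i) = 0

lemma sm_int (f g : 𝓢(E3, ℝ)) : Integrable (fun x => f x * g x) := (BC.sch f).int g

lemma int_swap (i j : Fin 3) (f g : 𝓢(E3, ℝ)) :
    ∫ x, dd i f x * dd j g x = ∫ x, dd j f x * dd i g x := by
  have h1 := int_mul_dd i f (dd j g)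
  have h2 := int_mul_dd j f (dd i g)
  rw [dd_comm i j g] at h1
  linarith

lemma int_GG (v : Fin 3 → 𝓢(E3, ℝ)) (hv : DF v) :
    ∑ i, ∑ j, ∫ x, dd i (v j) x * dd j (v i) x = 0 := by
  have h : ∀ i j, ∫ x, dd i (v j) x * dd j (v i) x = ∫ x, dd i (v i) x * dd j (v j) x := by
    intro i j
    rw [int_swap i j (v j) (v i)]
    congr 1; ext x; ring
  simp only [h]
  have h2 : ∀ x, ∑ i, ∑ j, dd i (v i) x * dd j (v j) x = 0 := by
    intro x
    rw [← Finset.sum_mul_sum, ← sch_sum_apply, hv]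
    simp
  have h3 : ∫ x, ∑ i, ∑ j, dd i (v i) x * dd j (v j) x = 0 := by simp [h2]
  rw [integral_finsetSum _ fun i _ => integrable_finsetSum _ fun j _ => sm_int _ _] at h3
  rw [← h3]
  refine Finset.sum_congr rfl fun i _ => ?_
  rw [integral_finsetSum _ fun j _ => sm_int _ _]

lemma int_W_sq (v : Fin 3 → 𝓢(E3, ℝ)) (hv : DF v) :
    ∫ x, ∑ k, W v k x ^ 2 = 2 * ∫ x, rho (St v) x := by
  have h0 := int_GG v hv
  have e : ∀ x, ∑ k, W v k x ^ 2 = 2 * rho (St v) x - 2 * ∑ i, ∑ j, dd i (v j) x * dd j (v i) x := by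
    intro x
    rw [rho_apply, Fintype.sum_prod_type]
    simp only [St_apply, Fin.sum_univ_three, W, Matrix.cons_val, sub_apply]
    ring
  simp only [e]
  have i1 : Integrable (fun x => ∑ i, ∑ j, dd i (v j) x * dd j (v i) x) :=
    integrable_finsetSum _ fun i _ => integrable_finsetSum _ fun j _ => sm_int _ _
  have h2 : ∫ x, ∑ i, ∑ j, dd i (v j) x * dd j (v i) x = 0 := by
    rw [integral_finsetSum _ fun i _ => integrable_finsetSum _ fun j _ => sm_int _ _, ← h0]
    refine Finset.sum_congr rfl fun i _ => ?_
    rw [integral_finsetSum _ fun j _ => sm_int _ _]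
  rw [integral_sub ((rho (St v)).integrable.const_mul _) (i1.const_mul _), integral_const_mul,
    integral_const_mul, h2]
  ring

lemma int_dW_sq (v : Fin 3 → 𝓢(E3, ℝ)) (hv : DF v) :
    ∫ x, ∑ k, ∑ l, dd l (W v k) x ^ 2 = 2 * ∫ x, gD (St v) x := by
  have hl : ∀ l, DF (fun i => dd l (v i)) := by
    intro l
    unfold DF at hv ⊢
    simp only [fun i => dd_comm i l (v i)]
    rw [← dd_sum, hv, dd_zero]
  have hW : ∀ l k x, W (fun i => dd l (v i)) k x = dd l (W v k) x := by
    intro l k x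
    fin_cases k <;> simp [W, dd_sub, dd_comm l]
  have hS : ∀ l p x, St (fun i => dd l (v i)) p x = dd l (St v p) x := by
    intro l p x
    simp [St, dd_smul, dd_add, dd_comm l]
  have h := fun l => int_W_sq _ (hl l)
  simp only [hW, rho_apply, hS] at h
  have h2 := Finset.sum_congr rfl fun l (_ : l ∈ (Finset.univ : Finset (Fin 3))) => h l
  have hi : ∀ (l : Fin 3) (f : 𝓢(E3, ℝ)), Integrable (fun x => dd l f x ^ 2) := fun l f => by
    simpa [sq] using sm_int (dd l f) (dd l f)
  rw [← integral_finsetSum _ fun l _ => integrable_finsetSum _ fun k _ => hi _ _, ← Finset.mul_sum,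
    ← integral_finsetSum _ fun l _ => integrable_finsetSum _ fun k _ => hi _ _] at h2
  simp only [gD_apply]
  simp only [Finset.sum_comm (s := (Finset.univ : Finset (Fin 3 × Fin 3)))]
  rw [← h2]
  congr 1; ext x
  rw [Finset.sum_comm]

lemma int_det (f g h : 𝓢(E3, ℝ)) :
    ∫ x, (dd 0 f x * (dd 1 g x * dd 2 h x - dd 2 g x * dd 1 h x) +
      dd 1 f x * (dd 2 g x * dd 0 h x - dd 0 g x * dd 2 h x) +
      dd 2 f x * (dd 0 g x * dd 1 h x - dd 1 g x * dd 0 h x)) = 0 := by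
  set c : Fin 3 → 𝓢(E3, ℝ) := ![sm (dd 1 g) (dd 2 h) - sm (dd 2 g) (dd 1 h),
    sm (dd 2 g) (dd 0 h) - sm (dd 0 g) (dd 2 h), sm (dd 0 g) (dd 1 h) - sm (dd 1 g) (dd 0 h)] with hc
  have e : ∀ x, (dd 0 f x * (dd 1 g x * dd 2 h x - dd 2 g x * dd 1 h x) +
      dd 1 f x * (dd 2 g x * dd 0 h x - dd 0 g x * dd 2 h x) +
      dd 2 f x * (dd 0 g x * dd 1 h x - dd 1 g x * dd 0 h x)) = ∑ j, dd j f x * c j x := by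
    intro x
    simp [Fin.sum_univ_three, hc, sm_apply]
  have hdiv : ∀ x, ∑ j, f x * dd j (c j) x = 0 := by
    intro x
    rw [← Finset.mul_sum]
    simp only [Fin.sum_univ_three, hc, Matrix.cons_val, dd_sub, dd_sm, sub_apply, add_apply, sm_apply]
    rw [dd_comm 1 0 g, dd_comm 1 0 h, dd_comm 2 0 g, dd_comm 2 0 h, dd_comm 2 1 g, dd_comm 2 1 h]
    ring
  have h1 : ∀ j, ∫ x, dd j f x * c j x = - ∫ x, f x * dd j (c j) x := fun j => by
    rw [int_mul_dd j f (c j)]; ring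
  simp only [e]
  rw [integral_finsetSum _ fun j _ => sm_int _ _]
  simp only [h1]
  rw [Finset.sum_neg_distrib, ← integral_finsetSum _ fun j _ => sm_int _ _]
  simp [hdiv]

/-- constant -/
def gc : ℝ := √(8 / 27)

lemma gc_sq : gc ^ 2 = 8 / 27 := Real.sq_sqrt (by norm_num)
lemma gc_pos : 0 < gc := Real.sqrt_pos.2 (by norm_num)

/-- vortex stretching density -/
def stretch (v : Fin 3 → 𝓢(E3, ℝ)) (x : E3) : ℝ := ∑ k, W v k x * ∑ j, St v (k, j) x * W v j x

lemma stretch_sch (v : Fin 3 → 𝓢(E3, ℝ)) :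
    ∃ s : 𝓢(E3, ℝ), ∀ x, s x = stretch v x := by
  refine ⟨∑ k, sm (W v k) (∑ j, sm (St v (k, j)) (W v j)), fun x => ?_⟩
  simp [stretch, sm_apply]

lemma stretch_le (v : Fin 3 → 𝓢(E3, ℝ)) (hv : DF v) :
    ∫ x, stretch v x ≤ gc * ∫ x, √(rho (St v) x) * rho (St v) x := by
  have hdet := int_det (v 0) (v 1) (v 2)
  obtain ⟨s, hs⟩ := stretch_sch v
  set d : 𝓢(E3, ℝ) := sm (dd 0 (v 0)) (sm (dd 1 (v 1)) (dd 2 (v 2)) - sm (dd 2 (v 1)) (dd 1 (v 2))) +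
      sm (dd 1 (v 0)) (sm (dd 2 (v 1)) (dd 0 (v 2)) - sm (dd 0 (v 1)) (dd 2 (v 2))) +
      sm (dd 2 (v 0)) (sm (dd 0 (v 1)) (dd 1 (v 2)) - sm (dd 1 (v 1)) (dd 0 (v 2))) with hd
  have hd0 : ∫ x, d x = 0 := by
    rw [← hdet]
    congr 1
  have hsd : ∫ x, stretch v x = ∫ x, (s x - 4 * d x) := by
    rw [integral_sub s.integrable (d.integrable.const_mul _), integral_const_mul, hd0]
    simp [hs]
  rw [hsd, ← integral_const_mul]
  refine integral_mono (s.integrable.sub (d.integrable.const_mul _))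
    (((sqrt_rho_BC (St v)).int _).const_mul _) fun x => ?_
  have hdivx : dd 0 (v 0) x + dd 1 (v 1) x + dd 2 (v 2) x = 0 := by
    have := congrArg (fun f : 𝓢(E3, ℝ) => f x) hv
    simpa [sch_sum_apply, Fin.sum_univ_three] using this
  have hb := det_bound (St v (0,0) x) (St v (1,1) x) (St v (2,2) x) (St v (0,1) x) (St v (0,2) x)
    (St v (1,2) x) (by simp only [St_apply]; linarith)
  set dt := St v (0,0) x * St v (1,1) x * St v (2,2) x + 2 * St v (0,1) x * St v (0,2) x * St v (1,2) x
    - St v (0,0) x * St v (1,2) x ^ 2 - St v (1,1) x * St v (0,2) x ^ 2 - St v (2,2) x * St v (0,1) x ^ 2 with hdt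
  have hr : St v (0,0) x ^ 2 + St v (1,1) x ^ 2 + St v (2,2) x ^ 2 +
      2 * (St v (0,1) x ^ 2 + St v (0,2) x ^ 2 + St v (1,2) x ^ 2) = rho (St v) x := by
    rw [rho_apply, Fintype.sum_prod_type]
    simp only [St_apply, Fin.sum_univ_three]
    ring
  rw [hr] at hb
  have hr0 := rho_nonneg (St v) x
  have hp : s x - 4 * d x = -4 * dt := by
    rw [hs, stretch, hd, hdt]
    simp only [St_apply, Fin.sum_univ_three, W, Matrix.cons_val, sub_apply, add_apply, sm_apply]
    ring
  simp only []
  rw [hp]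
  have hq := Real.sq_sqrt hr0
  have hg := gc_pos
  apply (le_abs_self _).trans
  apply abs_le_of_sq_le_sq _ (by positivity)
  have : (gc * (√(rho (St v) x) * rho (St v) x)) ^ 2 = 8 / 27 * rho (St v) x ^ 3 := by
    rw [mul_pow, mul_pow, gc_sq, hq]; ring
  rw [this]
  linarith

lemma enst_bound {ν : ℝ} (hν : 0 < ν) (v : Fin 3 → 𝓢(E3, ℝ)) (hv : DF v)
    (hM : 0 < 1 / 2 * ∫ x, ∑ k, W v k x ^ 2) :
    - ν * (∫ x, ∑ k, ∑ l, dd l (W v k) x ^ 2) + ∫ x, stretch v x ≤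
      1 / (3456 * π ^ 4 * ν ^ 3) * (1 / 2 * ∫ x, ∑ k, W v k x ^ 2) ^ 3 := by
  have h1 := stretch_le v hv
  rw [int_W_sq v hv, ← mul_assoc] at hM ⊢
  rw [int_dW_sq v hv]
  norm_num at hM
  set M := ∫ x, rho (St v) x
  set A := ∫ x, gD (St v) x with hAdef
  have hA : 0 ≤ A := integral_nonneg fun x => gD_nonneg _ _
  have hg := gc_pos
  have hpi := Real.pi_pos
  have hpi2 : π < 3.15 := Real.pi_lt_d2
  have h2 := GN (St v) (a := 0.95 * M / (96 * π ^ 2 * ν ^ 2)) (τ := 2.1 * ν / gc) (by positivity) (by positivity)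
  have h3 := h1.trans (mul_le_mul_of_nonneg_left h2 hg.le)
  set a := 0.95 * M / (96 * π ^ 2 * ν ^ 2) with ha
  have ha0 : 0 < a := by positivity
  have e1 : gc * (2.1 * ν / gc / 2 * (A + a ^ 2 * M) +
      1 / (2 * (2.1 * ν / gc)) * (1 / (12 * π * a) * (1 / 2 * A * M + a ^ 2 * M ^ 2))) =
      1.05 * ν * (A + a ^ 2 * M) + gc ^ 2 / (4.2 * ν) * (M / (12 * π * a)) * (1 / 2 * A + a ^ 2 * M) := by
    field_simp
    ring
  have e2 : M / (12 * π * a) = 8 * π * ν ^ 2 / 0.95 := by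
    rw [ha]; field_simp; norm_num
  rw [e1, gc_sq, e2] at h3
  have e3 : 8 / 27 / (4.2 * ν) * (8 * π * ν ^ 2 / 0.95) = ν * (π * (64 / (27 * 4.2 * 0.95))) := by
    field_simp; norm_num
  rw [e3] at h3
  have e4 : a ^ 2 * M * ν = (0.95 ^ 2 / 9216) * (M ^ 3 / (π ^ 4 * ν ^ 3)) := by
    rw [ha]; field_simp; norm_num
  have e5 : 1 / (3456 * π ^ 4 * ν ^ 3) * (1 / 2 * 2 * M) ^ 3 = 1 / 3456 * (M ^ 3 / (π ^ 4 * ν ^ 3)) := by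
    field_simp
  rw [e5]
  set Q := M ^ 3 / (π ^ 4 * ν ^ 3)
  have hQ : 0 < Q := by positivity
  have hc : π * (64 / (27 * 4.2 * 0.95)) ≤ 1.88 := by
    norm_num at hpi2 ⊢
    linarith
  set κ := π * (64 / (27 * 4.2 * 0.95))
  have h5 : κ * (ν * A) ≤ 1.88 * (ν * A) := mul_le_mul_of_nonneg_right hc (by positivity)
  have h6 : κ * (a ^ 2 * M * ν) ≤ 1.88 * (a ^ 2 * M * ν) := mul_le_mul_of_nonneg_right hc (by positivity)
  have h7 : 2.93 * (a ^ 2 * M * ν) ≤ 1 / 3456 * Q := by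
    rw [e4]; norm_num; nlinarith
  have h8 : 0 ≤ ν * A := by positivity
  norm_num at *
  nlinarith

end NS

namespace NS

/-- right side of the vorticity equation -/
def RR (ν : ℝ) (v : Fin 3 → 𝓢(E3, ℝ)) (k : Fin 3) : 𝓢(E3, ℝ) :=
  ν • (∑ i, dd i (dd i (W v k))) - (∑ i, sm (v i) (dd i (W v k))) + ∑ j, sm (St v (k, j)) (W v j)

lemma RR_apply (ν : ℝ) (v : Fin 3 → 𝓢(E3, ℝ)) (k : Fin 3) (x : E3) :
    RR ν v k x = ν * (∑ i, dd i (dd i (W v k)) x) - (∑ i, v i x * dd i (W v k) x)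
      + ∑ j, St v (k, j) x * W v j x := by
  simp [RR, sm_apply]

lemma transport_zero (v : Fin 3 → 𝓢(E3, ℝ)) (hv : DF v) (w : 𝓢(E3, ℝ)) :
    ∫ x, w x * ∑ i, v i x * dd i w x = 0 := by
  have h0 : ∫ x, (∑ i, dd i (sm (v i) (sm w w))) x = 0 := by
    simp only [sch_sum_apply]
    rw [integral_finsetSum _ fun i _ => (dd i (sm (v i) (sm w w))).integrable]
    simp [int_dd]
  have h1 : ∀ x, (∑ i, dd i (sm (v i) (sm w w))) x = 2 * (w x * ∑ i, v i x * dd i w x) := by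
    intro x
    have hd : ∑ i, dd i (v i) x = 0 := by
      have := congrArg (fun f : 𝓢(E3, ℝ) => f x) hv
      simpa [DF] using this
    simp only [dd_sm, sch_sum_apply, add_apply, sm_apply]
    simp only [Fin.sum_univ_three] at hd ⊢
    linear_combination (w x * w x) * hd
  simp only [h1] at h0
  rw [integral_const_mul] at h0
  linarith

lemma energy (ν : ℝ) (v : Fin 3 → 𝓢(E3, ℝ)) (hv : DF v) :
    ∫ x, ∑ k, W v k x * RR ν v k x =
      - ν * (∫ x, ∑ k, ∑ l, dd l (W v k) x ^ 2) + ∫ x, stretch v x := by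
  have i1 : ∀ k, Integrable (fun x => W v k x * (ν * ∑ i, dd i (dd i (W v k)) x)) := fun k => by
    have := sm_int (W v k) (ν • (∑ i, dd i (dd i (W v k))))
    simpa [sch_sum_apply] using this
  have i2 : ∀ k, Integrable (fun x => W v k x * (∑ i, v i x * dd i (W v k) x)) := fun k => by
    have := sm_int (W v k) (∑ i, sm (v i) (dd i (W v k)))
    simpa [sch_sum_apply, sm_apply] using this
  have i3 : ∀ k, Integrable (fun x => W v k x * (∑ j, St v (k, j) x * W v j x)) := fun k => by
    have := sm_int (W v k) (∑ j, sm (St v (k, j)) (W v j))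
    simpa [sch_sum_apply, sm_apply] using this
  have e1 : ∀ k, ∫ x, W v k x * (ν * ∑ i, dd i (dd i (W v k)) x) =
      - ν * ∫ x, ∑ l, dd l (W v k) x ^ 2 := by
    intro k
    rw [integral_finsetSum _ fun l _ => by
      have := sm_int (dd l (W v k)) (dd l (W v k)); simpa [sq] using this]
    have : ∀ x, W v k x * (ν * ∑ i, dd i (dd i (W v k)) x) =
        ν * ∑ i, W v k x * dd i (dd i (W v k)) x := fun x => by
      rw [Finset.mul_sum, Finset.mul_sum, Finset.mul_sum]
      exact Finset.sum_congr rfl fun i _ => by ring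
    simp only [this]
    rw [integral_const_mul, integral_finsetSum _ fun i _ => sm_int _ _]
    simp only [int_mul_dd, Finset.sum_neg_distrib, sq]
    ring
  have ig : ∀ k, Integrable (fun x => ∑ l, dd l (W v k) x ^ 2) := fun k =>
    integrable_finsetSum _ fun l _ => by
      have := sm_int (dd l (W v k)) (dd l (W v k)); simpa [sq] using this
  have hk : ∀ k, ∫ x, W v k x * RR ν v k x = - ν * (∫ x, ∑ l, dd l (W v k) x ^ 2) +
      ∫ x, W v k x * (∑ j, St v (k, j) x * W v j x) := by
    intro k
    have : ∀ x, W v k x * RR ν v k x = (W v k x * (ν * ∑ i, dd i (dd i (W v k)) x) -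
        W v k x * (∑ i, v i x * dd i (W v k) x)) + W v k x * (∑ j, St v (k, j) x * W v j x) := by
      intro x; rw [RR_apply]; ring
    simp only [this]
    have i12 : Integrable (fun x => W v k x * (ν * ∑ i, dd i (dd i (W v k)) x) -
        W v k x * (∑ i, v i x * dd i (W v k) x)) := (i1 k).sub (i2 k)
    rw [integral_add i12 (i3 k), integral_sub (i1 k) (i2 k),
      transport_zero v hv, e1]
    ring
  rw [integral_finsetSum _ fun k _ => sm_int _ _]
  simp only [hk]
  rw [Finset.sum_add_distrib, ← Finset.mul_sum, ← integral_finsetSum _ fun k _ => ig k,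
    ← integral_finsetSum _ fun k _ => i3 k]
  rfl

/-- uniform Schwartz bounds -/
def FB (K : Set ℝ) (f : ℝ → 𝓢(E3, ℝ)) : Prop := Bornology.IsVonNBounded ℝ (f '' K)

lemma FB.dd {K : Set ℝ} {f : ℝ → 𝓢(E3, ℝ)} (h : FB K f) (i : Fin 3) : FB K (fun t => dd i (f t)) := by
  have := Bornology.IsVonNBounded.image h (LineDeriv.lineDerivOpCLM ℝ 𝓢(E3, ℝ) (ee i))
  rw [Set.image_image] at this
  exact this

lemma FB.sub {K : Set ℝ} {f g : ℝ → 𝓢(E3, ℝ)} (h : FB K f) (h' : FB K g) :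
    FB K (fun t => f t - g t) := by
  refine (Bornology.IsVonNBounded.sub h h').subset ?_
  rintro _ ⟨t, ht, rfl⟩
  exact Set.sub_mem_sub ⟨t, ht, rfl⟩ ⟨t, ht, rfl⟩

lemma FB.bound {K : Set ℝ} {f : ℝ → 𝓢(E3, ℝ)} (h : FB K f) :
    ∃ C : ℝ, 0 < C ∧ ∀ t ∈ K, ∀ x, |f t x| ≤ C * (1 + ‖x‖) ^ (-(4:ℝ)) := by
  have h2 := ((schwartz_withSeminorms ℝ E3 ℝ).image_isVonNBounded_iff_finset_seminorm_bounded f).1 h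
  obtain ⟨r, hr, hb⟩ := h2 (Finset.Iic (4, 0))
  refine ⟨2 ^ 4 * r, by positivity, fun t ht x => ?_⟩
  have h3 := SchwartzMap.one_add_le_sup_seminorm_apply (𝕜 := ℝ) (m := (4, 0)) (k := 4) (n := 0)
    le_rfl le_rfl (f t) x
  have h4 := hb t ht
  rw [norm_iteratedFDeriv_zero, Real.norm_eq_abs] at h3
  have hp : (0:ℝ) < 1 + ‖x‖ := by positivity
  rw [Real.rpow_neg hp.le, ← div_eq_mul_inv, le_div_iff₀ (by positivity)]
  have h5 : (1 + ‖x‖) ^ (4:ℝ) = (1 + ‖x‖) ^ 4 := by norm_cast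
  rw [h5, mul_comm]
  refine h3.trans ?_
  have h6 : ((Finset.Iic ((4:ℕ), (0:ℕ))).sup fun m : ℕ × ℕ => SchwartzMap.seminorm ℝ m.1 m.2) (f t) ≤ r := h4.le
  show (2:ℝ) ^ 4 * _ ≤ _
  exact mul_le_mul_of_nonneg_left h6 (by norm_num)

lemma FB.bound1 {K : Set ℝ} {f : ℝ → 𝓢(E3, ℝ)} (h : FB K f) :
    ∃ C : ℝ, 0 < C ∧ ∀ t ∈ K, ∀ x, |f t x| ≤ C := by
  obtain ⟨C, hC, hb⟩ := h.bound
  refine ⟨C, hC, fun t ht x => (hb t ht x).trans ?_⟩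
  have : (1 + ‖x‖) ^ (-(4:ℝ)) ≤ 1 := Real.rpow_le_one_of_one_le_of_nonpos (by simp) (by norm_num)
  nlinarith

lemma jap_int : Integrable (fun x : E3 => (1 + ‖x‖) ^ (-(4:ℝ))) :=
  integrable_one_add_norm (by simp; norm_num)

variable {ν : ℝ} {T : ℝ≥0∞}

lemma sol_FB (sol : AdmissibleSolution ν T) {K : Set ℝ} (hK : IsCompact K) (hKT : K ⊆ timeSet T)
    (i : Fin 3) : FB K (fun t => sol.u t i) := by
  refine ((schwartz_withSeminorms ℝ E3 ℝ).image_isVonNBounded_iff_seminorm_bounded _).2 ?_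
  rintro ⟨k, n⟩
  obtain ⟨C, hC⟩ := sol.seminorm_bdd K hK hKT k n i
  refine ⟨|C| + 1, by positivity, fun t ht => ?_⟩
  have := (hC t ht).1
  have h2 := le_abs_self C
  show SchwartzMap.seminorm ℝ k n (sol.u t i) < _
  linarith

lemma sol_FB_W (sol : AdmissibleSolution ν T) {K : Set ℝ} (hK : IsCompact K) (hKT : K ⊆ timeSet T)
    (k : Fin 3) : FB K (fun t => W (sol.u t) k) := by
  have h := sol_FB sol hK hKT
  fin_cases k
  · exact ((h 2).dd 1).sub ((h 1).dd 2)
  · exact ((h 0).dd 2).sub ((h 2).dd 0)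
  · exact ((h 1).dd 0).sub ((h 0).dd 1)

lemma sol_bound_W (sol : AdmissibleSolution ν T) {K : Set ℝ} (hK : IsCompact K)
    (hKT : K ⊆ timeSet T) :
    ∃ C : ℝ, 0 < C ∧ ∀ t ∈ K, ∀ k x, |W (sol.u t) k x| ≤ C * (1 + ‖x‖) ^ (-(4:ℝ)) := by
  choose C hC hb using fun k => (sol_FB_W sol hK hKT k).bound
  refine ⟨∑ k, C k, Finset.sum_pos (fun i _ => hC i) ⟨0, by simp⟩, fun t ht k x => (hb k t ht x).trans ?_⟩
  have : C k ≤ ∑ k, C k := Finset.single_le_sum (fun i _ => (hC i).le) (Finset.mem_univ k)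
  exact mul_le_mul_of_nonneg_right this (by positivity)

lemma sol_bound_R (sol : AdmissibleSolution ν T) {K : Set ℝ} (hK : IsCompact K)
    (hKT : K ⊆ timeSet T) :
    ∃ C : ℝ, 0 < C ∧ ∀ t ∈ K, ∀ k x, |RR ν (sol.u t) k x| ≤ C := by
  choose a ha hba using fun k => (sol_FB_W sol hK hKT k).bound1
  choose b hb hbb using fun k i => ((sol_FB_W sol hK hKT k).dd i).bound1
  choose c hc hbc using fun k i => (((sol_FB_W sol hK hKT k).dd i).dd i).bound1
  choose d hd hbd using fun k => (sol_FB sol hK hKT k).bound1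
  choose e he hbe using fun k i => ((sol_FB sol hK hKT k).dd i).bound1
  have key : ∀ k, ∃ C : ℝ, 0 < C ∧ ∀ t ∈ K, ∀ x, |RR ν (sol.u t) k x| ≤ C := by
    intro k
    refine ⟨|ν| * (∑ i, c k i) + (∑ i, d i * b k i) + (∑ j, (e j k + e k j) / 2 * a j) + 1, ?_, ?_⟩
    · have h1 : 0 ≤ ∑ i, c k i := Finset.sum_nonneg fun i _ => (hc k i).le
      have h2 : 0 ≤ ∑ i, d i * b k i := Finset.sum_nonneg fun i _ => (mul_pos (hd i) (hb k i)).le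
      have h3 : 0 ≤ ∑ j, (e j k + e k j) / 2 * a j := Finset.sum_nonneg fun j _ => by
        have := he j k; have := he k j; have := ha j; positivity
      positivity
    · intro t ht x
      rw [RR_apply]
      have h1 : |ν * ∑ i, dd i (dd i (W (sol.u t) k)) x| ≤ |ν| * ∑ i, c k i := by
        rw [abs_mul]
        exact mul_le_mul_of_nonneg_left ((Finset.abs_sum_le_sum_abs _ _).trans
          (Finset.sum_le_sum fun i _ => hbc k i t ht x)) (abs_nonneg _)
      have h2 : |∑ i, sol.u t i x * dd i (W (sol.u t) k) x| ≤ ∑ i, d i * b k i := by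
        refine (Finset.abs_sum_le_sum_abs _ _).trans (Finset.sum_le_sum fun i _ => ?_)
        rw [abs_mul]
        exact mul_le_mul (hbd i t ht x) (hbb k i t ht x) (abs_nonneg _) (hd i).le
      have h3 : |∑ j, St (sol.u t) (k, j) x * W (sol.u t) j x| ≤ ∑ j, (e j k + e k j) / 2 * a j := by
        refine (Finset.abs_sum_le_sum_abs _ _).trans (Finset.sum_le_sum fun j _ => ?_)
        rw [abs_mul]
        refine mul_le_mul ?_ (hba j t ht x) (abs_nonneg _) (by
          have := he j k; have := he k j; positivity)
        rw [St_apply, abs_div, abs_two]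
        have q1 := hbe j k t ht x
        have q2 := hbe k j t ht x
        have := abs_add_le (dd k (sol.u t j) x) (dd j (sol.u t k) x)
        linarith
      have h4 := abs_add_le (ν * (∑ i, dd i (dd i (W (sol.u t) k)) x) - (∑ i, sol.u t i x * dd i (W (sol.u t) k) x)) (∑ j, St (sol.u t) (k, j) x * W (sol.u t) j x)
      have h5 := abs_sub (ν * (∑ i, dd i (dd i (W (sol.u t) k)) x)) (∑ i, sol.u t i x * dd i (W (sol.u t) k) x)
      linarith
  choose C hC hb using key
  refine ⟨∑ k, C k, Finset.sum_pos (fun i _ => hC i) ⟨0, by simp⟩, fun t ht k x => (hb k t ht x).trans ?_⟩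
  exact Finset.single_le_sum (fun i _ => (hC i).le) (Finset.mem_univ k)

lemma timeSet_sub {t : ℝ} (ht : t ∈ timeSet T) : Set.Icc 0 t ⊆ timeSet T := fun s hs =>
  ⟨hs.1, (ENNReal.ofReal_le_ofReal hs.2).trans_lt ht.2⟩

lemma timeSet_ext {t : ℝ} (ht : t ∈ timeSet T) : ∃ r, t < r ∧ r ∈ timeSet T := by
  have ho : IsOpen {s : ℝ | ENNReal.ofReal s < T} := isOpen_lt ENNReal.continuous_ofReal continuous_const
  obtain ⟨e, he, hb⟩ := Metric.isOpen_iff.1 ho t ht.2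
  refine ⟨t + e / 2, by linarith, by linarith [ht.1], hb ?_⟩
  rw [Metric.mem_ball, Real.dist_eq, add_sub_cancel_left, abs_of_pos (by positivity)]
  linarith

lemma timeSet_convex : Convex ℝ (timeSet T) := by
  apply Set.OrdConnected.convex
  refine ⟨fun a ha b hb c hc => ⟨ha.1.trans hc.1, (ENNReal.ofReal_le_ofReal hc.2).trans_lt hb.2⟩⟩

lemma timeSet_uniq (hT : 0 < T) : UniqueDiffOn ℝ (timeSet T) := by
  obtain ⟨r, hr, hr2⟩ := timeSet_ext (T := T) (t := 0) ⟨le_rfl, by simpa using hT⟩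
  refine uniqueDiffOn_convex timeSet_convex ?_
  refine ⟨r / 2, mem_interior_iff_mem_nhds.2 (Filter.mem_of_superset
    (Icc_mem_nhds (by linarith) (by linarith)) (timeSet_sub hr2))⟩

lemma DF_sol (sol : AdmissibleSolution ν T) {t : ℝ} (ht : t ∈ timeSet T) : DF (sol.u t) := by
  unfold DF
  ext x
  have := sol.divfree t ht x
  simpa [dd_pd] using this

lemma dd_diff (sol : AdmissibleSolution ν T) (hT : 0 < T) {t : ℝ} (ht : t ∈ timeSet T) (i j : Fin 3)
    (x : E3) : DifferentiableWithinAt ℝ (fun s => dd i (sol.u s j) x) (timeSet T) t := by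
  set S : Set (ℝ × E3) := timeSet T ×ˢ Set.univ with hS
  set g : ℝ × E3 → ℝ := fun p => sol.u p.1 j p.2 with hg
  have hu : UniqueDiffOn ℝ S := (timeSet_uniq hT).prod uniqueDiffOn_univ
  have hsm : ContDiffOn ℝ (⊤ : ℕ∞) g S := sol.smooth j
  have h1 : ContDiffOn ℝ 1 (fderivWithin ℝ g S) S := hsm.fderivWithin hu (by
    exact WithTop.coe_le_coe.2 (le_top : (1 + 1 : ℕ∞) ≤ ⊤))
  have h2 : DifferentiableOn ℝ (fun p => fderivWithin ℝ g S p (0, ee i)) S := by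
    intro p hp
    exact ((h1.differentiableOn (by norm_num)) p hp).clm_apply (differentiableWithinAt_const _)
  have h3 : ∀ s ∈ timeSet T, dd i (sol.u s j) x = fderivWithin ℝ g S (s, x) (0, ee i) := by
    intro s hs
    have hd : HasFDerivWithinAt g (fderivWithin ℝ g S (s, x)) S (s, x) :=
      ((hsm.differentiableOn (by simp)) (s, x) ⟨hs, trivial⟩).hasFDerivWithinAt
    have hi : HasFDerivWithinAt (fun y : E3 => (s, y)) (ContinuousLinearMap.inr ℝ ℝ E3) Set.univ x :=
      (hasFDerivAt_prodMk_right s x).hasFDerivWithinAt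
    have hc := hd.comp x hi (fun y _ => ⟨hs, trivial⟩)
    have hc' := hasFDerivWithinAt_univ.1 hc
    have e : dd i (sol.u s j) x = fderiv ℝ (g ∘ fun y : E3 => (s, y)) x (ee i) := rfl
    rw [e, hc'.fderiv]
    simp
  have h4 : DifferentiableWithinAt ℝ (fun s => fderivWithin ℝ g S (s, x) (0, ee i)) (timeSet T) t := by
    have := (h2 (t, x) ⟨ht, trivial⟩)
    exact DifferentiableWithinAt.comp t this (f := fun s : ℝ => (s, x))
      (DifferentiableWithinAt.prodMk differentiableWithinAt_id (differentiableWithinAt_const _))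
      (fun s hs => ⟨hs, trivial⟩)
  exact h4.congr (fun s hs => h3 s hs) (h3 t ht)

lemma W_diff (sol : AdmissibleSolution ν T) (hT : 0 < T) {t : ℝ} (ht : t ∈ timeSet T) (k : Fin 3)
    (x : E3) : HasDerivWithinAt (fun s => W (sol.u s) k x) (RR ν (sol.u t) k x) (timeSet T) t := by
  have h := dd_diff sol hT ht
  have h1 : DifferentiableWithinAt ℝ (fun s => W (sol.u s) k x) (timeSet T) t := by
    fin_cases k
    · exact (h 1 2 x).sub (h 2 1 x)
    · exact (h 2 0 x).sub (h 0 2 x)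
    · exact (h 0 1 x).sub (h 1 0 x)
  have h2 := h1.hasDerivWithinAt
  have h3 := sol.vort_eq t ht x k
  simp only [W_curl, St_strain, ← dd_pd] at h3
  rw [RR_apply]
  refine h2.congr_deriv ?_
  linarith

lemma enst_W (sol : AdmissibleSolution ν T) (t : ℝ) :
    sol.enstrophy t = 1 / 2 * ∫ x, ∑ k, W (sol.u t) k x ^ 2 := by
  simp only [AdmissibleSolution.enstrophy, AdmissibleSolution.vort, W_curl]

lemma W_sq_int (v : Fin 3 → 𝓢(E3, ℝ)) : Integrable fun x => ∑ k, W v k x ^ 2 :=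
  integrable_finsetSum _ fun k _ => by
    have := sm_int (W v k) (W v k); simpa [sq] using this

lemma enst_cont0 (sol : AdmissibleSolution ν T) (hT : 0 < T) :
    ContinuousWithinAt sol.enstrophy (Set.Ici 0) 0 := by
  have h0 : (0:ℝ) ∈ timeSet T := ⟨le_rfl, by simpa using hT⟩
  obtain ⟨r, hr, hr2⟩ := timeSet_ext h0
  obtain ⟨C, hC, hb⟩ := sol_bound_W sol isCompact_Icc (timeSet_sub hr2)
  have hmem : Set.Icc 0 r ∈ nhdsWithin (0:ℝ) (Set.Ici 0) := Icc_mem_nhdsGE hr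
  have key : ContinuousWithinAt (fun t => ∫ x, ∑ k, W (sol.u t) k x ^ 2) (Set.Ici 0) 0 := by
    refine continuousWithinAt_of_dominated (bound := fun x => 3 * C ^ 2 * (1 + ‖x‖) ^ (-(4:ℝ))) ?_ ?_ ?_ ?_
    · exact Filter.Eventually.of_forall fun t => (W_sq_int _).aestronglyMeasurable
    · filter_upwards [hmem] with t ht
      refine Filter.Eventually.of_forall fun x => ?_
      have hj1 : (1 + ‖x‖) ^ (-(4:ℝ)) ≤ 1 := Real.rpow_le_one_of_one_le_of_nonpos (by simp) (by norm_num)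
      have hj0 : 0 ≤ (1 + ‖x‖) ^ (-(4:ℝ)) := by positivity
      rw [Real.norm_eq_abs, abs_of_nonneg (Finset.sum_nonneg fun k _ => sq_nonneg _)]
      have : ∀ k, W (sol.u t) k x ^ 2 ≤ C ^ 2 * (1 + ‖x‖) ^ (-(4:ℝ)) := by
        intro k
        have h1 := hb t ht k x
        have h2 : W (sol.u t) k x ^ 2 ≤ (C * (1 + ‖x‖) ^ (-(4:ℝ))) ^ 2 := by
          rw [← sq_abs]; exact pow_le_pow_left₀ (abs_nonneg _) h1 2
        refine h2.trans ?_
        rw [mul_pow]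
        refine mul_le_mul_of_nonneg_left ?_ (by positivity)
        nlinarith
      have h5 := Finset.sum_le_sum fun k (_ : k ∈ (Finset.univ : Finset (Fin 3))) => this k
      simp only [Finset.sum_const, Finset.card_univ, Fintype.card_fin, nsmul_eq_mul] at h5
      refine h5.trans (le_of_eq ?_)
      push_cast; ring
    · exact jap_int.const_mul _
    · refine Filter.Eventually.of_forall fun x => ?_
      have : ∀ k, ContinuousWithinAt (fun s => W (sol.u s) k x) (Set.Ici 0) 0 := fun k =>
        ((W_diff sol hT h0 k x).continuousWithinAt.mono (timeSet_sub hr2)).mono_of_mem_nhdsWithin hmem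
      exact tendsto_finsetSum _ fun k _ => (this k).pow 2
  have := key.const_mul (1/2)
  exact this.congr (fun t _ => enst_W sol t) (enst_W sol 0)

lemma enst_deriv (sol : AdmissibleSolution ν T) (hT : 0 < T) {t : ℝ} (ht : t ∈ timeSet T)
    (h0 : 0 < t) :
    HasDerivAt sol.enstrophy (- ν * (∫ x, ∑ k, ∑ l, dd l (W (sol.u t) k) x ^ 2) +
      ∫ x, stretch (sol.u t) x) t := by
  obtain ⟨r, hr, hr2⟩ := timeSet_ext ht
  obtain ⟨C, hC, hb⟩ := sol_bound_W sol isCompact_Icc (timeSet_sub hr2)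
  obtain ⟨D, hD, hbD⟩ := sol_bound_R sol isCompact_Icc (timeSet_sub hr2)
  have hmem : Set.Ioo 0 r ∈ nhds t := Ioo_mem_nhds h0 hr
  have key := (hasDerivAt_integral_of_dominated_loc_of_deriv_le (μ := volume)
    (F := fun t x => ∑ k, W (sol.u t) k x ^ 2)
    (F' := fun t x => ∑ k, 2 * (W (sol.u t) k x * RR ν (sol.u t) k x))
    (bound := fun x => 6 * C * D * (1 + ‖x‖) ^ (-(4:ℝ))) (x₀ := t) hmem
    (Filter.Eventually.of_forall fun t => (W_sq_int _).aestronglyMeasurable) (W_sq_int _)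
    ?_ ?_ ?_ ?_).2
  · have h2 := key.const_mul (1/2)
    have h3 : sol.enstrophy = fun t => 1 / 2 * ∫ x, ∑ k, W (sol.u t) k x ^ 2 :=
      funext (enst_W sol)
    rw [h3]
    refine h2.congr_deriv ?_
    simp only [← Finset.mul_sum]
    rw [integral_const_mul, energy ν _ (DF_sol sol ht)]
    ring
  · refine (integrable_finsetSum _ fun k _ => (sm_int _ _).const_mul 2).aestronglyMeasurable
  · refine Filter.Eventually.of_forall fun x s hs => ?_
    have hs' : s ∈ Set.Icc 0 r := ⟨hs.1.le, hs.2.le⟩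
    rw [Real.norm_eq_abs]
    refine (Finset.abs_sum_le_sum_abs _ _).trans ?_
    have : ∀ k, |2 * (W (sol.u s) k x * RR ν (sol.u s) k x)| ≤ 2 * (C * (1 + ‖x‖) ^ (-(4:ℝ)) * D) := by
      intro k
      rw [abs_mul, abs_two, abs_mul]
      have := mul_le_mul (hb s hs' k x) (hbD s hs' k x) (abs_nonneg _) (by positivity)
      linarith
    have h5 := Finset.sum_le_sum fun k (_ : k ∈ (Finset.univ : Finset (Fin 3))) => this k
    refine h5.trans (le_of_eq ?_)
    simp only [Finset.sum_const, Finset.card_univ, Fintype.card_fin, nsmul_eq_mul]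
    push_cast; ring
  · exact jap_int.const_mul _
  · refine Filter.Eventually.of_forall fun x s hs => ?_
    have hsT : s ∈ timeSet T := timeSet_sub hr2 ⟨hs.1.le, hs.2.le⟩
    have hn : timeSet T ∈ nhds s := Filter.mem_of_superset (Icc_mem_nhds hs.1 hs.2) (timeSet_sub hr2)
    refine HasDerivAt.fun_sum fun k _ => ?_
    refine (((W_diff sol hT hsT k x).hasDerivAt hn).pow 2).congr_deriv ?_
    norm_num
    ring

end NS

namespace NS

lemma bdry_deriv {c A t : ℝ} (h : 0 < 1 - 2 * c * A ^ 2 * t) :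
    HasDerivAt (fun s => A / √(1 - 2 * c * A ^ 2 * s)) (c * (A / √(1 - 2 * c * A ^ 2 * t)) ^ 3) t := by
  have h1 : HasDerivAt (fun s : ℝ => 1 - 2 * c * A ^ 2 * s) (-(2 * c * A ^ 2)) t := by
    have := ((hasDerivAt_id t).const_mul (2 * c * A ^ 2)).const_sub 1
    simpa using this
  have h2 := h1.sqrt h.ne'
  have hs : 0 < √(1 - 2 * c * A ^ 2 * t) := Real.sqrt_pos.2 h
  have h3 := (hasDerivAt_const t A).div h2 hs.ne'
  refine h3.congr_deriv ?_
  field_simp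
  ring

lemma ode_compare {E : ℝ → ℝ} {E' : ℝ → ℝ} {c t₀ : ℝ} (hc : 0 < c) (ht₀ : 0 < t₀)
    (hcont : ContinuousWithinAt E (Set.Ici 0) 0)
    (hd : ∀ t ∈ Set.Ioc 0 t₀, HasDerivAt E (E' t) t)
    (hb : ∀ t ∈ Set.Ioc 0 t₀, 0 < E t → E' t ≤ c * E t ^ 3) (hE : 0 < E 0)
    (hlt : 2 * c * E 0 ^ 2 * t₀ < 1) :
    E t₀ ≤ E 0 / √(1 - 2 * c * E 0 ^ 2 * t₀) := by
  have step : ∀ ε : ℝ, 0 < ε → 2 * (c + ε) * (E 0 + ε) ^ 2 * t₀ < 1 →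
      E t₀ ≤ (E 0 + ε) / √(1 - 2 * (c + ε) * (E 0 + ε) ^ 2 * t₀) := by
    intro ε hε hlt'
    have hev : ∀ᶠ s in nhdsWithin 0 (Set.Ioi (0:ℝ)), E s < E 0 + ε :=
      (hcont.mono Set.Ioi_subset_Ici_self).eventually (gt_mem_nhds (by linarith))
    obtain ⟨s, hs1, hs2⟩ := (hev.and (Ioo_mem_nhdsGT ht₀)).exists
    have hpos : ∀ t, t ≤ t₀ → 0 < 1 - 2 * (c + ε) * (E 0 + ε) ^ 2 * t := by
      intro t ht
      have : 2 * (c + ε) * (E 0 + ε) ^ 2 * t ≤ 2 * (c + ε) * (E 0 + ε) ^ 2 * t₀ :=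
        mul_le_mul_of_nonneg_left ht (by positivity)
      linarith
    have hBd : ∀ t, t ≤ t₀ → HasDerivAt (fun s => (E 0 + ε) / √(1 - 2 * (c + ε) * (E 0 + ε) ^ 2 * s))
      ((c + ε) * ((E 0 + ε) / √(1 - 2 * (c + ε) * (E 0 + ε) ^ 2 * t)) ^ 3) t := fun t ht =>
        bdry_deriv (hpos t ht)
    refine image_le_of_deriv_right_lt_deriv_boundary' (f := E) (f' := E') (a := s) (b := t₀)
      (B := fun s => (E 0 + ε) / √(1 - 2 * (c + ε) * (E 0 + ε) ^ 2 * s))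
      (B' := fun t => (c + ε) * ((E 0 + ε) / √(1 - 2 * (c + ε) * (E 0 + ε) ^ 2 * t)) ^ 3)
      ?_ ?_ ?_ ?_ ?_ ?_ (Set.right_mem_Icc.2 hs2.2.le)
    · exact fun t ht => (hd t ⟨hs2.1.trans_le ht.1, ht.2⟩).continuousAt.continuousWithinAt
    · exact fun t ht => (hd t ⟨hs2.1.trans_le ht.1, ht.2.le⟩).hasDerivWithinAt
    · refine hs1.le.trans ?_
      have h1 := hpos s hs2.2.le
      rw [le_div_iff₀ (Real.sqrt_pos.2 h1)]
      have h2 : √(1 - 2 * (c + ε) * (E 0 + ε) ^ 2 * s) ≤ 1 := by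
        refine Real.sqrt_le_iff.2 ⟨by norm_num, ?_⟩
        have : 0 ≤ 2 * (c + ε) * (E 0 + ε) ^ 2 * s := by
          have := hs2.1
          positivity
        linarith
      nlinarith
    · exact fun t ht => (hBd t ht.2).continuousAt.continuousWithinAt
    · exact fun t ht => (hBd t ht.2.le).hasDerivWithinAt
    · intro t ht heq
      have hB : 0 < (E 0 + ε) / √(1 - 2 * (c + ε) * (E 0 + ε) ^ 2 * t) :=
        div_pos (by linarith) (Real.sqrt_pos.2 (hpos t ht.2.le))
      rw [← heq] at hB ⊢
      have h1 := hb t ⟨hs2.1.trans_le ht.1, ht.2.le⟩ hB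
      have : 0 < ε * E t ^ 3 := by positivity
      linarith
  have hc1 : ContinuousAt (fun ε : ℝ => 2 * (c + ε) * (E 0 + ε) ^ 2 * t₀) 0 := by fun_prop
  have hsq : 0 < √(1 - 2 * c * E 0 ^ 2 * t₀) := Real.sqrt_pos.2 (by linarith)
  have hc2 : ContinuousAt (fun ε : ℝ => (E 0 + ε) / √(1 - 2 * (c + ε) * (E 0 + ε) ^ 2 * t₀)) 0 := by
    refine ContinuousAt.div (by fun_prop) (by fun_prop) ?_
    simpa using hsq.ne'
  have hlim : Filter.Tendsto (fun ε : ℝ => (E 0 + ε) / √(1 - 2 * (c + ε) * (E 0 + ε) ^ 2 * t₀))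
      (nhdsWithin 0 (Set.Ioi 0)) (nhds (E 0 / √(1 - 2 * c * E 0 ^ 2 * t₀))) := by
    have := hc2.tendsto.mono_left (nhdsWithin_le_nhds (s := Set.Ioi (0:ℝ)))
    simpa using this
  refine ge_of_tendsto hlim ?_
  have hev : ∀ᶠ ε in nhdsWithin 0 (Set.Ioi (0:ℝ)), 2 * (c + ε) * (E 0 + ε) ^ 2 * t₀ < 1 :=
    (hc1.tendsto.mono_left (nhdsWithin_le_nhds (s := Set.Ioi (0:ℝ)))).eventually
      (gt_mem_nhds (by simpa using hlt))
  filter_upwards [hev, self_mem_nhdsWithin] with ε h1 h2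
  exact step ε h2 h1

lemma main {ν : ℝ} (hν : 0 < ν) {T : ℝ≥0∞} (hT : 0 < T) (sol : AdmissibleSolution ν T)
    (hE0 : 0 < sol.enstrophy 0) {t : ℝ} (ht : t ∈ timeSet T)
    (hlt : t < 1728 * π ^ 4 * ν ^ 3 / (sol.enstrophy 0) ^ 2) :
    sol.enstrophy t ≤ sol.enstrophy 0 /
      Real.sqrt (1 - (sol.enstrophy 0) ^ 2 * t / (1728 * π ^ 4 * ν ^ 3)) := by
  have hpi := Real.pi_pos
  rcases ht.1.eq_or_lt with h0 | h0
  · rw [← h0]; simp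
  have e : 2 * (1 / (3456 * π ^ 4 * ν ^ 3)) * sol.enstrophy 0 ^ 2 * t =
      (sol.enstrophy 0) ^ 2 * t / (1728 * π ^ 4 * ν ^ 3) := by
    field_simp; norm_num
  rw [← e]
  refine ode_compare (by positivity) h0 (enst_cont0 sol hT)
    (fun s hs => enst_deriv sol hT (timeSet_sub ht ⟨hs.1.le, hs.2⟩) hs.1) ?_ hE0 ?_
  · intro s hs hp
    rw [enst_W] at hp ⊢
    exact enst_bound hν _ (DF_sol sol (timeSet_sub ht ⟨hs.1.le, hs.2⟩)) hp
  · rw [e, div_lt_one (by positivity)]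
    rw [lt_div_iff₀ (by positivity)] at hlt
    linarith

end NS

/-- For an admissible solution of the vorticity equation on `[0,T)` with viscosity
`ν > 0` and `E(0) > 0`: for all `t ∈ [0,T)` with `t < 1728 π⁴ ν³ / E(0)²`,
`E(t) ≤ E(0) / √(1 − E(0)² t / (1728 π⁴ ν³))`. -/
theorem statement7 (ν : ℝ) (hν : 0 < ν) (T : ℝ≥0∞) (hT : 0 < T)
    (sol : AdmissibleSolution ν T) (hE0 : 0 < sol.enstrophy 0) :
    ∀ t ∈ timeSet T, t < 1728 * π ^ 4 * ν ^ 3 / (sol.enstrophy 0) ^ 2 →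
      sol.enstrophy t ≤ sol.enstrophy 0 /
        Real.sqrt (1 - (sol.enstrophy 0) ^ 2 * t / (1728 * π ^ 4 * ν ^ 3)) := by
  intro t ht hlt
  exact NS.main hν hT sol hE0 ht hlt
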